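/- arXiv:math/0601471 — 2 statements merged into one kernel-verified Lean document; each statement's English description precedes it below -/
import Mathlib

section
/- The smallest subspace of F that contains W_𝔞 = ℂ_r[𝐱]·ℂ_r[𝐲] and is invariant under all of the intermediate Wakimoto operators ρ(E_i)_m, ρ(F_i)_m, ρ(H_i)_m (1 ≤ i ≤ n, m ∈ ℤ) is exactly ℂ[𝐱]·ℂ_n[𝐲], the span of products u·v with u ∈ ℂ[x_{ij,m} : 1 ≤ i ≤ j ≤ n, m ∈ ℤ] and v ∈ ℂ_n[𝐲]. (That is, the intermediate Wakimoto module W_𝔤(λ̃) = ℂ[𝐱]⊗ℂ_n[𝐲] is generated over the affine algebra by its subspace W_𝔞(λ̃_r) = ℂ_r[𝐱]⊗ℂ_r[𝐲].) -/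
open MvPolynomial

/-- The Cartan matrix of `sl(n+1, ℂ)` in 1-based indices. -/
noncomputable def cartanEntry (i j : ℕ) : ℂ :=
  if i = j then 2 else if i + 1 = j ∨ j + 1 = i then -1 else 0

/-- The entries of the matrix `𝔅` (1-based indices). -/
noncomputable def Bentry (r : ℕ) (γ : ℂ) (i j : ℕ) : ℂ :=
  cartanEntry i j *
    (γ ^ 2 - (if r < i then 1 else 0) * (if r < j then 1 else 0) * ((r : ℂ) + 1)
      + ((r : ℂ) / 2) * (if i = r + 1 then 1 else 0) * (if j = r + 1 then 1 else 0))

/-- Index set for the variables `x_{ij,m}`, `1 ≤ i ≤ j ≤ n`, `m ∈ ℤ`. -/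
abbrev XIdx (n : ℕ) : Type := {v : ℕ × ℕ // 1 ≤ v.1 ∧ v.1 ≤ v.2 ∧ v.2 ≤ n} × ℤ

/-- Index set for the variables `y_{k,m}`, `1 ≤ k ≤ n` (encoded by `Fin n`,
`k ↦ k + 1`) and `m ≥ 1`. -/
abbrev YIdx (n : ℕ) : Type := Fin n × {m : ℕ // 1 ≤ m}

/-- The Fock space `F = ℂ[x_{ij,m}; y_{k,m}]`. -/
abbrev FSp (n : ℕ) : Type := MvPolynomial (XIdx n ⊕ YIdx n) ℂ

/-- The operator `a_{ij,m}`: it is `∂/∂x_{ij,m}` if `m ≥ 0` and `j ≤ r`, and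
multiplication by `x_{ij,m}` otherwise (and junk `0` for invalid indices `i, j`,
which are never used).  Applied to any fixed polynomial, all the `∑ᶠ` sums
appearing below have finite support, so they compute the intended operators. -/
noncomputable def aop (n r i j : ℕ) (m : ℤ) : FSp n → FSp n :=
  if h : 1 ≤ i ∧ i ≤ j ∧ j ≤ n then
    (if 0 ≤ m ∧ j ≤ r then fun q => pderiv (Sum.inl (⟨(i, j), h⟩, m)) q
     else fun q => X (Sum.inl (⟨(i, j), h⟩, m)) * q)
  else 0

/-- The operator `a*_{ij,m}`: multiplication by `x_{ij,−m}` if `m ≤ 0` and `j ≤ r`,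
and `−∂/∂x_{ij,−m}` otherwise. -/
noncomputable def astarop (n r i j : ℕ) (m : ℤ) : FSp n → FSp n :=
  if h : 1 ≤ i ∧ i ≤ j ∧ j ≤ n then
    (if m ≤ 0 ∧ j ≤ r then fun q => X (Sum.inl (⟨(i, j), h⟩, -m)) * q
     else fun q => -pderiv (Sum.inl (⟨(i, j), h⟩, -m)) q)
  else 0

/-- The polynomial `e_i·𝐲_m = Σ_{k=1}^n (e_i)_k y_{k,m}`. -/
noncomputable def yPoly (n : ℕ) (e : ℕ → ℕ → ℂ) (i : ℕ) (m : {m : ℕ // 1 ≤ m}) :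
    FSp n :=
  ∑ k : Fin n, e i (k.1 + 1) • X (Sum.inr (k, m))

/-- The operator `b_{i,m}`:  `b_{i,0} = λ_i · id`; for `m > 0`, `b_{i,−m}` is
multiplication by `e_i·𝐲_m` and `b_{i,m} = m Σ_k (e_i)_k ∂/∂y_{k,m}`. -/
noncomputable def bop (n : ℕ) (e : ℕ → ℕ → ℂ) (lam : ℕ → ℂ) (i : ℕ) (m : ℤ) :
    FSp n → FSp n :=
  if h : 0 < m then
    fun q => (m : ℂ) • ∑ k : Fin n,
      e i (k.1 + 1) • pderiv (Sum.inr (k, ⟨m.toNat, by omega⟩)) q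
  else if h' : m = 0 then fun q => lam i • q
  else fun q => yPoly n e i ⟨(-m).toNat, by omega⟩ * q

/-- The normally ordered pair `:a_{ij,u} a*_{kl,v}:` : the annihilation operator
(`a_{ij,u}` with `u ≥ 0`, `j ≤ r`) is moved to the right of the creation operator. -/
noncomputable def nAA (n r i j k l : ℕ) (u v : ℤ) : FSp n → FSp n :=
  if 0 ≤ u ∧ j ≤ r then fun q => astarop n r k l v (aop n r i j u q)
  else fun q => aop n r i j u (astarop n r k l v q)

/-- Mode `m` (coefficient of `z^{−m−1}`) of the normally ordered product
`:a_{ij}(z) a*_{kl}(z):`. -/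
noncomputable def nAAmode (n r i j k l : ℕ) (m : ℤ) : FSp n → FSp n :=
  fun q => ∑ᶠ s : ℤ, nAA n r i j k l s (m - s) q

/-- Normal ordering of the mode `a*_{ij,s}` against an operator `B`: an
annihilating `a*_{ij,s}` (i.e. `s > 0` and `j ≤ r`, or `j > r`) is moved to the
right of `B`. -/
noncomputable def nStar (n r i j : ℕ) (s : ℤ) (B : FSp n → FSp n) : FSp n → FSp n :=
  if (j ≤ r ∧ 0 < s) ∨ r < j then fun q => B (astarop n r i j s q)
  else fun q => astarop n r i j s (B q)

/-- The intermediate Wakimoto mode operator `ρ(H_i)_m`. -/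
noncomputable def rhoH (n r : ℕ) (e : ℕ → ℕ → ℂ) (lam : ℕ → ℂ) (i : ℕ) (m : ℤ) :
    FSp n → FSp n :=
  fun q => (2 : ℂ) • nAAmode n r i i i i m q
    + ∑ j ∈ Finset.Ico 1 i,
        (nAAmode n r j i j i m q - nAAmode n r j (i - 1) j (i - 1) m q)
    + ∑ j ∈ Finset.Icc (i + 1) n,
        (nAAmode n r i j i j m q - nAAmode n r (i + 1) j (i + 1) j m q)
    + bop n e lam i m q

/-- The intermediate Wakimoto mode operator `ρ(F_i)_m`. -/
noncomputable def rhoF (n r i : ℕ) (m : ℤ) : FSp n → FSp n :=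
  fun q => aop n r i i m q
    + ∑ j ∈ Finset.Icc (i + 1) n,
        ∑ᶠ s : ℤ, aop n r i j s (astarop n r (i + 1) j (m - s) q)

/-- The intermediate Wakimoto mode operator `ρ(E_i)_m`. -/
noncomputable def rhoE (n r : ℕ) (γ : ℂ) (e : ℕ → ℕ → ℂ) (lam : ℕ → ℂ) (i : ℕ)
    (m : ℤ) : FSp n → FSp n :=
  fun q =>
    (∑ᶠ s : ℤ, nStar n r i i s
        ((∑ k ∈ Finset.Ico 1 i, nAAmode n r k (i - 1) k (i - 1) (m - s))
          - ∑ k ∈ Finset.Icc 1 i, nAAmode n r k i k i (m - s)) q)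
    + ∑ k ∈ Finset.Icc (i + 1) n,
        ∑ᶠ s : ℤ, aop n r (i + 1) k s (astarop n r i k (m - s) q)
    - ∑ k ∈ Finset.Ico 1 i,
        ∑ᶠ s : ℤ, aop n r k (i - 1) s (astarop n r k i (m - s) q)
    - ∑ᶠ s : ℤ, astarop n r i i s (bop n e lam i (m - s) q)
    - ((if r < i then (r : ℂ) + 1 else (i : ℂ) + 1) - γ ^ 2) •
        ((-(m : ℂ)) • astarop n r i i m q)

/-- Commutator of two operators. -/
noncomputable def opComm (n : ℕ) (A B : FSp n → FSp n) : FSp n → FSp n :=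
  fun q => A (B q) - B (A q)

/-- The subalgebra `ℂ_r[𝐱] = ℂ[x_{ij,m} : 1 ≤ i ≤ j ≤ r, m ∈ ℤ]` of `F`. -/
noncomputable def CrX (n r : ℕ) : Subalgebra ℂ (FSp n) :=
  Algebra.adjoin ℂ {q | ∃ v : XIdx n, v.1.1.2 ≤ r ∧ q = X (Sum.inl v)}

/-- The subalgebra `ℂ[𝐱]` of `F` generated by all of the `x` variables. -/
noncomputable def CX (n : ℕ) : Subalgebra ℂ (FSp n) :=
  Algebra.adjoin ℂ {q | ∃ v : XIdx n, q = X (Sum.inl v)}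

/-- The subalgebra `ℂ_s[𝐲]` of `F` generated by the elements `e_i·𝐲_m`,
`1 ≤ i ≤ s`, `m ≥ 1`. -/
noncomputable def CsY (n s : ℕ) (e : ℕ → ℕ → ℂ) : Subalgebra ℂ (FSp n) :=
  Algebra.adjoin ℂ
    {q | ∃ i : ℕ, ∃ m : {m : ℕ // 1 ≤ m}, 1 ≤ i ∧ i ≤ s ∧ q = yPoly n e i m}

/-- `W_𝔞 = ℂ_r[𝐱]·ℂ_r[𝐲]`, the span of the products `u·v` with `u ∈ ℂ_r[𝐱]`,
`v ∈ ℂ_r[𝐲]`. -/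
noncomputable def Wa (n r : ℕ) (e : ℕ → ℕ → ℂ) : Submodule ℂ (FSp n) :=
  Submodule.span ℂ {w | ∃ u ∈ CrX n r, ∃ v ∈ CsY n r e, w = u * v}

/-- If a subspace `U` containing `1` is stable under operators `x * · + D`, one for each `x` in
`s`, where `D` is a derivation preserving the span of `s`, then `U` contains the algebra
generated by `s`. -/
theorem adjoin_le_of_forall_mul_add_derivation_mem {R A : Type*} [CommRing R] [CommRing A]
    [Algebra R A] {s : Set A} {U : Submodule R A} (h1 : (1 : A) ∈ U)
    (h : ∀ x ∈ s, ∃ D : Derivation R A A, (∀ y ∈ s, D y ∈ Submodule.span R s) ∧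
      ∀ q ∈ U, x * q + D q ∈ U) :
    Subalgebra.toSubmodule (Algebra.adjoin R s) ≤ U := by
  set N : Submodule R A := Submodule.span R (insert 1 s) with hN
  have hs : ∀ x ∈ s, x ∈ N := fun x hx => Submodule.subset_span (Set.mem_insert_of_mem _ hx)
  have hsN : Submodule.span R s ≤ N := Submodule.span_mono (Set.subset_insert _ _)
  have h1N : (1 : Submodule R A) ≤ N :=
    Submodule.one_le.2 (Submodule.subset_span (Set.mem_insert _ _))
  have hD : ∀ D : Derivation R A A, (∀ y ∈ s, D y ∈ Submodule.span R s) →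
      ∀ d : ℕ, ∀ q ∈ N ^ d, D q ∈ N ^ d := by
    intro D hDs
    have hDN : ∀ y ∈ N, D y ∈ N := by
      intro y hy
      induction hy using Submodule.span_induction with
      | mem y hy =>
        rcases hy with rfl | hy
        · simp
        · exact hsN (hDs y hy)
      | zero => simp
      | add a b _ _ ha hb => rw [map_add]; exact add_mem ha hb
      | smul c a _ ha => rw [D.map_smul]; exact N.smul_mem c ha
    intro d
    induction d with
    | zero =>
      intro q hq
      rw [pow_zero, Submodule.mem_one] at hq
      obtain ⟨c, rfl⟩ := hq
      simp
    | succ d ih =>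
      intro q hq
      rw [pow_succ] at hq ⊢
      induction hq using Submodule.mul_induction_on' with
      | mem_mul_mem a ha b hb =>
        rw [Derivation.leibniz, smul_eq_mul, smul_eq_mul, mul_comm b]
        exact add_mem (Submodule.mul_mem_mul ha (hDN b hb)) (Submodule.mul_mem_mul (ih a ha) hb)
      | add a _ b _ ha hb => rw [map_add]; exact add_mem ha hb
  have hle : ∀ d : ℕ, N ^ d ≤ U := by
    intro d
    induction d with
    | zero => rw [pow_zero]; exact Submodule.one_le.2 h1
    | succ d ih =>
      rw [pow_succ', Submodule.mul_le]
      intro x hx q hq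
      induction hx using Submodule.span_induction with
      | mem x hx =>
        rcases hx with rfl | hx
        · rw [one_mul]; exact ih hq
        · obtain ⟨D, hDs, hU⟩ := h x hx
          simpa using sub_mem (hU q (ih hq)) (ih (hD D hDs d q hq))
      | zero => simp
      | add a b _ _ ha hb => rw [add_mul]; exact add_mem ha hb
      | smul c a _ ha => rw [smul_mul_assoc]; exact U.smul_mem c ha
  intro q hq
  suffices ∃ d : ℕ, q ∈ N ^ d from this.elim fun d hd => hle d hd
  have hmono : Monotone fun d : ℕ => N ^ d := pow_right_monotone h1N
  rw [Subalgebra.mem_toSubmodule] at hq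
  induction hq using Algebra.adjoin_induction with
  | mem x hx => exact ⟨1, by rw [pow_one]; exact hs x hx⟩
  | algebraMap c => exact ⟨0, by rw [pow_zero]; exact Submodule.mem_one.2 ⟨c, rfl⟩⟩
  | add a b _ _ ha hb =>
    obtain ⟨d, hd⟩ := ha
    obtain ⟨d', hd'⟩ := hb
    exact ⟨max d d', add_mem (hmono (le_max_left d d') hd) (hmono (le_max_right d d') hd')⟩
  | mul a b _ _ ha hb =>
    obtain ⟨d, hd⟩ := ha
    obtain ⟨d', hd'⟩ := hb
    exact ⟨d + d', by rw [pow_add]; exact Submodule.mul_mem_mul hd hd'⟩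

/-- A pointwise finite sum of derivations of a polynomial ring can be computed on the
variables. -/
theorem finsum_derivation_eq {ι σ R : Type*} [CommRing R]
    (G : ι → Derivation R (MvPolynomial σ R) (MvPolynomial σ R))
    (D : Derivation R (MvPolynomial σ R) (MvPolynomial σ R))
    (hfin : ∀ v, (Function.support fun s => G s (X v)).Finite)
    (h : ∀ v, ∑ᶠ s, G s (X v) = D (X v)) (q : MvPolynomial σ R) :
    ∑ᶠ s, G s q = D q := by
  suffices H : (Function.support fun s => G s q).Finite ∧ ∑ᶠ s, G s q = D q from H.2
  induction q using MvPolynomial.induction_on with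
  | C a => simp
  | add p q hp hq =>
    simp only [map_add]
    refine ⟨(hp.1.union hq.1).subset (Function.support_add _ _), ?_⟩
    rw [finsum_add_distrib hp.1 hq.1, hp.2, hq.2]
  | mul_X p v hp =>
    simp only [Derivation.leibniz, smul_eq_mul]
    have h₁ : (Function.support fun s => p * G s (X v)).Finite :=
      (hfin v).subset (Function.support_mul_subset_right _ _)
    have h₂ : (Function.support fun s => X v * G s p).Finite :=
      hp.1.subset (Function.support_mul_subset_right _ _)
    refine ⟨(h₁.union h₂).subset (Function.support_add _ _), ?_⟩
    rw [finsum_add_distrib h₁ h₂, ← mul_finsum' _ _ (hfin v), ← mul_finsum' _ _ hp.1, h v, hp.2]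

/-- A derivation mapping the generators of a subalgebra into it preserves the subalgebra. -/
theorem Derivation.mem_adjoin_of_forall_mem {R A : Type*} [CommRing R] [CommRing A] [Algebra R A]
    (D : Derivation R A A) {s : Set A} (h : ∀ x ∈ s, D x ∈ Algebra.adjoin R s) {q : A}
    (hq : q ∈ Algebra.adjoin R s) : D q ∈ Algebra.adjoin R s := by
  induction hq using Algebra.adjoin_induction with
  | mem x hx => exact h x hx
  | algebraMap c => simp
  | add a b _ _ ha hb => rw [map_add]; exact add_mem ha hb
  | mul a b ha' hb' ha hb =>
    rw [Derivation.leibniz]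
    exact add_mem (mul_mem ha' hb) (mul_mem hb' ha)

/-- A derivation vanishing on the generators of a subalgebra vanishes on the subalgebra. -/
theorem Derivation.eq_zero_of_mem_adjoin {R A : Type*} [CommRing R] [CommRing A] [Algebra R A]
    (D : Derivation R A A) {s : Set A} (h : ∀ x ∈ s, D x = 0) {q : A}
    (hq : q ∈ Algebra.adjoin R s) : D q = 0 :=
  Derivation.eqOn_adjoin (D2 := 0) (fun x hx => by simpa using h x hx) hq

/-- The generators `x_{ij,m}` with `j ≤ k`. -/
def xGens (n k : ℕ) : Set (FSp n) := {q | ∃ v : XIdx n, v.1.1.2 ≤ k ∧ q = X (Sum.inl v)}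

/-- The generators `x_{ij,m}` with `r < j`. -/
def xGensAbove (n r : ℕ) : Set (FSp n) := {q | ∃ v : XIdx n, r < v.1.1.2 ∧ q = X (Sum.inl v)}

/-- The generators `e_i·𝐲_m` with `1 ≤ i ≤ l`. -/
def yGens (n l : ℕ) (e : ℕ → ℕ → ℂ) : Set (FSp n) :=
  {q | ∃ i : ℕ, ∃ m : {m : ℕ // 1 ≤ m}, 1 ≤ i ∧ i ≤ l ∧ q = yPoly n e i m}

/-- The subalgebra generated by the `x_{ij,m}` with `j ≤ k` and the `e_i·𝐲_m` with
`1 ≤ i ≤ l`. -/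
noncomputable def xyAlg (n k l : ℕ) (e : ℕ → ℕ → ℂ) : Subalgebra ℂ (FSp n) :=
  Algebra.adjoin ℂ (xGens n k ∪ yGens n l e)

theorem xGens_self (n : ℕ) : xGens n n = {q | ∃ v : XIdx n, q = X (Sum.inl v)} := by
  ext q
  exact ⟨fun ⟨v, _, h⟩ => ⟨v, h⟩, fun ⟨v, h⟩ => ⟨v, v.1.2.2.2, h⟩⟩

theorem CX_eq (n : ℕ) : CX n = Algebra.adjoin ℂ (xGens n n) := by
  rw [xGens_self]; rfl

theorem span_mul_eq_xyAlg (n k l : ℕ) (e : ℕ → ℕ → ℂ) :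
    Submodule.span ℂ {w | ∃ u ∈ Algebra.adjoin ℂ (xGens n k), ∃ v ∈ CsY n l e, w = u * v} =
      Subalgebra.toSubmodule (xyAlg n k l e) := by
  rw [xyAlg, Algebra.adjoin_union_coe_submodule, Submodule.mul_eq_span_mul_set]
  congr 1
  ext w
  simp only [Set.mem_ofPred_eq, Set.mem_mul, SetLike.mem_coe, Subalgebra.mem_toSubmodule]
  exact ⟨fun ⟨u, hu, v, hv, h⟩ => ⟨u, hu, v, hv, h.symm⟩,
    fun ⟨u, hu, v, hv, h⟩ => ⟨u, hu, v, hv, h.symm⟩⟩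

theorem X_mem_xyAlg {n k l : ℕ} {e : ℕ → ℕ → ℂ} {v : XIdx n} (hv : v.1.1.2 ≤ k) :
    X (Sum.inl v) ∈ xyAlg n k l e :=
  Algebra.subset_adjoin (Or.inl ⟨v, hv, rfl⟩)

theorem pderiv_inl_yPoly (n : ℕ) (e : ℕ → ℕ → ℂ) (v : XIdx n) (i : ℕ) (m : {m : ℕ // 1 ≤ m}) :
    pderiv (Sum.inl v) (yPoly n e i m) = 0 := by
  simp [yPoly]

theorem pderiv_X_mem {n : ℕ} (S : Subalgebra ℂ (FSp n)) (v : XIdx n ⊕ YIdx n)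
    (w : XIdx n ⊕ YIdx n) : pderiv v (X w : FSp n) ∈ S := by
  classical
  rw [pderiv_X, Pi.single_apply]
  split_ifs
  · exact one_mem _
  · exact zero_mem _

theorem pderiv_mem_xyAlg {n k l : ℕ} {e : ℕ → ℕ → ℂ} (v : XIdx n ⊕ YIdx n) {q : FSp n}
    (hq : q ∈ xyAlg n k l e) : pderiv v q ∈ xyAlg n k l e := by
  refine Derivation.mem_adjoin_of_forall_mem _ ?_ hq
  rintro x (⟨w, -, rfl⟩ | ⟨i, m, -, -, rfl⟩)
  · exact pderiv_X_mem _ _ _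
  · simp only [yPoly, map_sum, Derivation.map_smul]
    exact sum_mem fun k _ => Subalgebra.smul_mem _ (pderiv_X_mem _ _ _) _

theorem pderiv_inl_eq_zero_of_mem_xyAlg {n k l : ℕ} {e : ℕ → ℕ → ℂ} {v : XIdx n}
    (hv : k < v.1.1.2) {q : FSp n} (hq : q ∈ xyAlg n k l e) : pderiv (Sum.inl v) q = 0 := by
  refine Derivation.eq_zero_of_mem_adjoin _ ?_ hq
  rintro x (⟨w, hw, rfl⟩ | ⟨i, m, -, -, rfl⟩)
  · exact pderiv_X_of_ne fun h => by cases h; omega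
  · exact pderiv_inl_yPoly _ _ _ _ _

theorem pderiv_inl_eq_zero_of_mem_adjoin_xGensAbove {n r : ℕ} {v : XIdx n}
    (hv : v.1.1.2 ≤ r) {q : FSp n} (hq : q ∈ Algebra.adjoin ℂ (xGensAbove n r)) :
    pderiv (Sum.inl v) q = 0 := by
  refine Derivation.eq_zero_of_mem_adjoin _ ?_ hq
  rintro x ⟨w, hw, rfl⟩
  exact pderiv_X_of_ne fun h => by cases h; omega

theorem pderiv_inl_eq_zero_of_mem_CsY {n l : ℕ} {e : ℕ → ℕ → ℂ} (v : XIdx n)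
    {q : FSp n} (hq : q ∈ CsY n l e) : pderiv (Sum.inl v) q = 0 := by
  refine Derivation.eq_zero_of_mem_adjoin _ ?_ hq
  rintro x ⟨i, m, -, -, rfl⟩
  exact pderiv_inl_yPoly _ _ _ _ _

section Stability

variable {n k l : ℕ} {e : ℕ → ℕ → ℂ} {q : FSp n}

theorem aop_mem_xyAlg (r i j : ℕ) (hj : j ≤ k) (m : ℤ) (hq : q ∈ xyAlg n k l e) :
    aop n r i j m q ∈ xyAlg n k l e := by
  unfold aop
  split_ifs
  · exact pderiv_mem_xyAlg _ hq
  · exact mul_mem (X_mem_xyAlg hj) hq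
  · exact zero_mem _

theorem astarop_mem_xyAlg (r i j : ℕ) (hj : j ≤ k) (m : ℤ) (hq : q ∈ xyAlg n k l e) :
    astarop n r i j m q ∈ xyAlg n k l e := by
  unfold astarop
  split_ifs
  · exact mul_mem (X_mem_xyAlg hj) hq
  · exact neg_mem (pderiv_mem_xyAlg _ hq)
  · exact zero_mem _

theorem finsum_mem_subalgebra (S : Subalgebra ℂ (FSp n)) {f : ℤ → FSp n} (hf : ∀ s, f s ∈ S) :
    ∑ᶠ s, f s ∈ S :=
  finsum_induction (· ∈ S) (zero_mem _) (fun _ _ => add_mem) hf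

theorem nAAmode_mem_xyAlg (r i j i' j' : ℕ) (hj : j ≤ k) (hj' : j' ≤ k) (m : ℤ)
    (hq : q ∈ xyAlg n k l e) : nAAmode n r i j i' j' m q ∈ xyAlg n k l e := by
  refine finsum_mem_subalgebra _ fun s => ?_
  unfold nAA
  split_ifs
  · exact astarop_mem_xyAlg _ _ _ hj' _ (aop_mem_xyAlg _ _ _ hj _ hq)
  · exact aop_mem_xyAlg _ _ _ hj _ (astarop_mem_xyAlg _ _ _ hj' _ hq)

theorem bop_mem_xyAlg (lam : ℕ → ℂ) (i : ℕ) (hi : 1 ≤ i) (hil : i ≤ l) (m : ℤ)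
    (hq : q ∈ xyAlg n k l e) : bop n e lam i m q ∈ xyAlg n k l e := by
  unfold bop
  split_ifs with h h'
  · exact Subalgebra.smul_mem _
      (sum_mem fun j _ => Subalgebra.smul_mem _ (pderiv_mem_xyAlg _ hq) _) _
  · exact Subalgebra.smul_mem _ hq _
  · exact mul_mem (Algebra.subset_adjoin (Or.inr ⟨i, _, hi, hil, rfl⟩)) hq

theorem nStar_mem_xyAlg (r i j : ℕ) (hj : j ≤ k) (s : ℤ) {B : FSp n → FSp n}
    (hB : ∀ p ∈ xyAlg n k l e, B p ∈ xyAlg n k l e) (hq : q ∈ xyAlg n k l e) :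
    nStar n r i j s B q ∈ xyAlg n k l e := by
  unfold nStar
  split_ifs
  · exact hB _ (astarop_mem_xyAlg _ _ _ hj _ hq)
  · exact astarop_mem_xyAlg _ _ _ hj _ (hB _ hq)

theorem rhoE_mem_xyAlg (r : ℕ) (γ : ℂ) (lam : ℕ → ℂ) (i : ℕ) (hi : 1 ≤ i) (hin : i ≤ n) (m : ℤ)
    (hq : q ∈ xyAlg n n n e) : rhoE n r γ e lam i m q ∈ xyAlg n n n e := by
  refine sub_mem (sub_mem (sub_mem (add_mem ?_ ?_) ?_) ?_) ?_
  · refine finsum_mem_subalgebra _ fun s => nStar_mem_xyAlg _ _ _ hin _ (fun p hp => ?_) hq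
    rw [Pi.sub_apply, Finset.sum_apply, Finset.sum_apply]
    exact sub_mem
      (sum_mem fun k _ => nAAmode_mem_xyAlg _ _ _ _ _ (by omega) (by omega) _ hp)
      (sum_mem fun k _ => nAAmode_mem_xyAlg _ _ _ _ _ hin hin _ hp)
  · refine sum_mem fun k hk => finsum_mem_subalgebra _ fun s => ?_
    have hk := (Finset.mem_Icc.1 hk).2
    exact aop_mem_xyAlg _ _ _ hk _ (astarop_mem_xyAlg _ _ _ hk _ hq)
  · exact sum_mem fun k _ => finsum_mem_subalgebra _ fun s =>
      aop_mem_xyAlg _ _ _ (by omega) _ (astarop_mem_xyAlg _ _ _ hin _ hq)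
  · exact finsum_mem_subalgebra _ fun s =>
      astarop_mem_xyAlg _ _ _ hin _ (bop_mem_xyAlg _ _ hi hin _ hq)
  · exact Subalgebra.smul_mem _ (Subalgebra.smul_mem _ (astarop_mem_xyAlg _ _ _ hin _ hq) _) _

/-- The modes of `a_{ij}(z) a*_{i+1,j}(z)`. -/
noncomputable def aAstarMode (n r i j : ℕ) (m : ℤ) (q : FSp n) : FSp n :=
  ∑ᶠ s : ℤ, aop n r i j s (astarop n r (i + 1) j (m - s) q)

theorem aAstarMode_mem_xyAlg (r i j : ℕ) (hj : j ≤ k) (m : ℤ) (hq : q ∈ xyAlg n k l e) :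
    aAstarMode n r i j m q ∈ xyAlg n k l e :=
  finsum_mem_subalgebra _ fun _ => aop_mem_xyAlg _ _ _ hj _ (astarop_mem_xyAlg _ _ _ hj _ hq)

theorem rhoF_mem_xyAlg (r i : ℕ) (hin : i ≤ n) (m : ℤ)
    (hq : q ∈ xyAlg n n l e) : rhoF n r i m q ∈ xyAlg n n l e :=
  add_mem (aop_mem_xyAlg _ _ _ hin _ hq)
    (sum_mem fun _ hj => aAstarMode_mem_xyAlg _ _ _ (Finset.mem_Icc.1 hj).2 _ hq)

/-- The part of `ρ(H_i)_m` acting on the `x` variables. -/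
noncomputable def rhoHx (n r i : ℕ) (m : ℤ) (q : FSp n) : FSp n :=
  (2 : ℂ) • nAAmode n r i i i i m q
    + ∑ j ∈ Finset.Ico 1 i,
        (nAAmode n r j i j i m q - nAAmode n r j (i - 1) j (i - 1) m q)
    + ∑ j ∈ Finset.Icc (i + 1) n,
        (nAAmode n r i j i j m q - nAAmode n r (i + 1) j (i + 1) j m q)

theorem rhoH_eq (n r : ℕ) (e : ℕ → ℕ → ℂ) (lam : ℕ → ℂ) (i : ℕ) (m : ℤ) (q : FSp n) :
    rhoH n r e lam i m q = rhoHx n r i m q + bop n e lam i m q := rfl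

theorem rhoHx_mem_xyAlg (r i : ℕ) (hin : i ≤ n) (m : ℤ)
    (hq : q ∈ xyAlg n n l e) : rhoHx n r i m q ∈ xyAlg n n l e := by
  refine add_mem (add_mem (Subalgebra.smul_mem _ (nAAmode_mem_xyAlg _ _ _ _ _ hin hin _ hq) _)
    (sum_mem fun _ _ => sub_mem (nAAmode_mem_xyAlg _ _ _ _ _ hin hin _ hq)
      (nAAmode_mem_xyAlg _ _ _ _ _ (by omega) (by omega) _ hq)))
    (sum_mem fun j hj => ?_)
  have hj := (Finset.mem_Icc.1 hj).2
  exact sub_mem (nAAmode_mem_xyAlg _ _ _ _ _ hj hj _ hq) (nAAmode_mem_xyAlg _ _ _ _ _ hj hj _ hq)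

end Stability

section Multiplication

variable {n : ℕ} {p q : FSp n}

theorem aop_mul (r i j : ℕ) (m : ℤ)
    (hq : ∀ v : XIdx n, v.1.1.2 = j → pderiv (Sum.inl v) q = 0) :
    aop n r i j m (p * q) = aop n r i j m p * q := by
  unfold aop
  split_ifs
  · simp [hq, mul_comm]
  · exact (mul_assoc _ _ _).symm
  · simp

theorem astarop_mul (r i j : ℕ) (m : ℤ)
    (hq : ∀ v : XIdx n, v.1.1.2 = j → pderiv (Sum.inl v) q = 0) :
    astarop n r i j m (p * q) = astarop n r i j m p * q := by
  unfold astarop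
  split_ifs
  · exact (mul_assoc _ _ _).symm
  · simp [hq, mul_comm]
  · simp

theorem aAstarMode_mul (r i j : ℕ) (m : ℤ)
    (hq : ∀ v : XIdx n, v.1.1.2 = j → pderiv (Sum.inl v) q = 0) :
    aAstarMode n r i j m (p * q) = aAstarMode n r i j m p * q := by
  simp only [aAstarMode, finsum_mul, astarop_mul r _ j _ hq, aop_mul r _ j _ hq]

theorem nAAmode_mul (r i j i' j' : ℕ) (m : ℤ) (hq : ∀ v : XIdx n, pderiv (Sum.inl v) q = 0) :
    nAAmode n r i j i' j' m (p * q) = nAAmode n r i j i' j' m p * q := by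
  rw [nAAmode, nAAmode, finsum_mul]
  refine finsum_congr fun s => ?_
  unfold nAA
  split_ifs <;> simp only [astarop_mul r _ _ _ fun v _ => hq v, aop_mul r _ _ _ fun v _ => hq v]

theorem rhoHx_mul (r i : ℕ) (m : ℤ) (hq : ∀ v : XIdx n, pderiv (Sum.inl v) q = 0) :
    rhoHx n r i m (p * q) = rhoHx n r i m p * q := by
  simp only [rhoHx, nAAmode_mul r _ _ _ _ _ hq, add_mul, Finset.sum_mul, sub_mul, smul_mul_assoc]

end Multiplication

/-- The variable `x_{ij,m}`, and `0` for invalid indices. -/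
noncomputable def xVar (n i j : ℕ) (m : ℤ) : FSp n :=
  if h : 1 ≤ i ∧ i ≤ j ∧ j ≤ n then X (Sum.inl (⟨(i, j), h⟩, m)) else 0

/-- The derivation `x_{i+1,j,t} ↦ -x_{i,j,t+m}`, killing all other variables. -/
noncomputable def shiftDer (n i j : ℕ) (m : ℤ) : Derivation ℂ (FSp n) (FSp n) :=
  mkDerivation ℂ (Sum.elim
    (fun v => if v.1.1 = (i + 1, j) then -xVar n i j (v.2 + m) else 0) 0)

/-- The derivation `x_{i+1,j,t} ↦ -x_{i,j,t+m}` for all `j > r`, killing all other variables. -/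
noncomputable def rowDer (n r i : ℕ) (m : ℤ) : Derivation ℂ (FSp n) (FSp n) :=
  ∑ j ∈ Finset.Icc (i + 1) n with r < j, shiftDer n i j m

/-- The generators `x_{ij,m}` for a fixed `j`. -/
def xColumn (n j : ℕ) : Set (FSp n) := {q | ∃ v : XIdx n, v.1.1.2 = j ∧ q = X (Sum.inl v)}

theorem rowDer_apply (n r i : ℕ) (m : ℤ) (q : FSp n) :
    rowDer n r i m q = ∑ j ∈ Finset.Icc (i + 1) n with r < j, shiftDer n i j m q := by
  rw [rowDer, ← Derivation.coeFnAddMonoidHom_apply, map_sum, Finset.sum_apply]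
  rfl

theorem rowDer_X (n r i : ℕ) (m : ℤ) (v : XIdx n) :
    rowDer n r i m (X (Sum.inl v)) =
      if v.1.1.1 = i + 1 ∧ r < v.1.1.2 then -xVar n i v.1.1.2 (v.2 + m) else 0 := by
  obtain ⟨⟨⟨a, b⟩, ha, hab, hb⟩, t⟩ := v
  simp only [rowDer_apply, shiftDer, mkDerivation_X, Sum.elim_inl, Prod.mk.injEq] at *
  split_ifs with h
  · rw [Finset.sum_eq_single b]
    · rw [if_pos ⟨h.1, rfl⟩]
    · intro j _ hj
      rw [if_neg fun h' => hj h'.2.symm]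
    · intro hb'
      refine absurd ?_ hb'
      rw [Finset.mem_filter, Finset.mem_Icc]
      omega
  · refine Finset.sum_eq_zero fun j hj => if_neg ?_
    rw [Finset.mem_filter] at hj
    rintro ⟨rfl, rfl⟩
    exact h ⟨rfl, hj.2⟩

theorem xVar_mem_span_xColumn (n i j : ℕ) (m : ℤ) :
    xVar n i j m ∈ Submodule.span ℂ (xColumn n j) := by
  unfold xVar
  split_ifs
  · exact Submodule.subset_span ⟨_, rfl, rfl⟩
  · exact zero_mem _

theorem rowDer_X_mem (n r i : ℕ) (m : ℤ) (v : XIdx n) :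
    rowDer n r i m (X (Sum.inl v)) ∈ Submodule.span ℂ (xColumn n v.1.1.2) := by
  rw [rowDer_X]
  split_ifs
  · exact neg_mem (xVar_mem_span_xColumn _ _ _ _)
  · exact zero_mem _

theorem aAstarMode_eq_shiftDer {n r i j : ℕ} (hi : 1 ≤ i) (hij : i < j) (hj : j ≤ n)
    (hr : r < j) (m : ℤ) (q : FSp n) : aAstarMode n r i j m q = shiftDer n i j m q := by
  have h₁ : 1 ≤ i ∧ i ≤ j ∧ j ≤ n := ⟨hi, hij.le, hj⟩
  have h₂ : 1 ≤ i + 1 ∧ i + 1 ≤ j ∧ j ≤ n := ⟨by omega, hij, hj⟩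
  let G : ℤ → Derivation ℂ (FSp n) (FSp n) := fun s =>
    -(xVar n i j s • pderiv (Sum.inl (⟨(i + 1, j), h₂⟩, -(m - s))))
  have hG : ∀ v s, G s (X v) ≠ 0 → v = Sum.inl (⟨(i + 1, j), h₂⟩, -(m - s)) := by
    intro v s h
    by_contra hv
    refine h ?_
    change -(xVar n i j s • pderiv _ (X v)) = 0
    rw [pderiv_X_of_ne hv, smul_zero, neg_zero]
  have hsupp : ∀ v, (Function.support fun s => G s (X v)).Subsingleton := by
    intro v s hs s' hs'
    have := (hG v s hs).symm.trans (hG v s' hs')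
    simp only [Sum.inl.injEq, Prod.mk.injEq, true_and] at this
    omega
  have : ∀ s, aop n r i j s (astarop n r (i + 1) j (m - s) q) = G s q := by
    intro s
    have hjr : ¬ j ≤ r := by omega
    simp [aop, astarop, G, xVar, h₁, h₂, hjr]
  simp only [aAstarMode, this]
  refine finsum_derivation_eq G _ (fun v => (hsupp v).finite) (fun v => ?_) q
  by_cases hv : ∃ t, v = Sum.inl (⟨(i + 1, j), h₂⟩, t)
  · obtain ⟨t, rfl⟩ := hv
    have hval : G (t + m) (X (Sum.inl (⟨(i + 1, j), h₂⟩, t))) = -xVar n i j (t + m) := by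
      simp [G]
    rw [finsum_eq_single _ (t + m), hval]
    · simp [shiftDer, mkDerivation_X]
    · intro s hs
      by_contra h
      have := hG _ _ h
      simp only [Sum.inl.injEq, Prod.mk.injEq, true_and] at this
      omega
  · have h0 : ∀ s, G s (X v) = 0 := by
      intro s
      by_contra h
      exact hv ⟨_, hG _ _ h⟩
    simp only [h0, finsum_zero, shiftDer, mkDerivation_X]
    rcases v with ⟨⟨v, hv'⟩, t⟩ | v
    · rw [Sum.elim_inl, if_neg]
      rintro rfl
      exact hv ⟨t, rfl⟩
    · rfl

/-- A subspace stable under the action of the simple lowering operators on the `x_{ij,m}`,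
`j > r`, is stable under the multiplication by each of these variables, up to a derivation. -/
theorem exists_derivation_xVar_mul_add_mem {n r : ℕ} {U : Submodule ℂ (FSp n)}
    (hU : ∀ i, 1 ≤ i → i ≤ n → ∀ m : ℤ, ∀ q ∈ U,
      (if r < i then xVar n i i m else 0) * q + rowDer n r i m q ∈ U)
    {i j : ℕ} (hij : i ≤ j) (hi : 1 ≤ i) (hj : j ≤ n) (hr : r < j) (m : ℤ) :
    ∃ D : Derivation ℂ (FSp n) (FSp n),
      (∀ v : XIdx n, D (X (Sum.inl v)) ∈ Submodule.span ℂ (xColumn n v.1.1.2)) ∧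
      (∀ v : XIdx n, v.1.1.2 ≤ j → D (X (Sum.inl v)) = 0) ∧
      ∀ q ∈ U, xVar n i j m * q + D q ∈ U := by
  induction hij using Nat.decreasingInduction with
  | self =>
    refine ⟨rowDer n r j m, rowDer_X_mem n r j m, fun v hv => ?_, fun q hq => ?_⟩
    · rw [rowDer_X, if_neg]
      have := v.1.2.2.1
      omega
    · simpa [hr] using hU j hi hj m q hq
  | of_succ i hij ih =>
    obtain ⟨D, hD, hD0, hDU⟩ := ih (by omega)
    have hspan : ∀ b, b ≤ j → ∀ p ∈ Submodule.span ℂ (xColumn n b), D p = 0 := by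
      intro b hb p hp
      induction hp using Submodule.span_induction with
      | mem p hp =>
        obtain ⟨v, hv, rfl⟩ := hp
        exact hD0 v (hv.trans_le hb)
      | zero => simp
      | add a b _ _ ha hb => rw [map_add, ha, hb, add_zero]
      | smul c a _ ha => rw [D.map_smul, ha, smul_zero]
    have hpres : ∀ E : Derivation ℂ (FSp n) (FSp n),
        (∀ v : XIdx n, E (X (Sum.inl v)) ∈ Submodule.span ℂ (xColumn n v.1.1.2)) →
        ∀ b, ∀ p ∈ Submodule.span ℂ (xColumn n b), E p ∈ Submodule.span ℂ (xColumn n b) := by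
      intro E hE b p hp
      induction hp using Submodule.span_induction with
      | mem p hp =>
        obtain ⟨v, rfl, rfl⟩ := hp
        exact hE v
      | zero => simp
      | add a b _ _ ha hb => rw [map_add]; exact add_mem ha hb
      | smul c a _ ha => rw [E.map_smul]; exact Submodule.smul_mem _ c ha
    have hrow := rowDer_X_mem n r i 0
    set c : FSp n := if r < i then xVar n i i 0 else 0 with hc
    have hDc : D c = 0 := by
      rw [hc]
      split_ifs
      · exact hspan i hij.le _ (xVar_mem_span_xColumn _ _ _ _)
      · simp
    have hx : rowDer n r i 0 (xVar n (i + 1) j m) = -xVar n i j m := by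
      have h₂ : 1 ≤ i + 1 ∧ i + 1 ≤ j ∧ j ≤ n := ⟨by omega, hij, hj⟩
      rw [xVar, dif_pos h₂, rowDer_X]
      simp [hr]
    refine ⟨⁅D, rowDer n r i 0⁆, fun v => ?_, fun v hv => ?_, fun q hq => ?_⟩
    · rw [Derivation.commutator_apply]
      exact sub_mem (hpres D hD _ _ (hrow v)) (hpres _ hrow _ _ (hD v))
    · rw [Derivation.commutator_apply, hD0 v hv, map_zero, sub_zero]
      exact hspan _ hv _ (hrow v)
    · have h₁ := hDU _ (hU i hi (by omega) 0 q hq)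
      have h₂ := hU i hi (by omega) 0 _ (hDU q hq)
      convert sub_mem h₁ h₂ using 1
      rw [← hc]
      simp only [map_add, Derivation.leibniz, smul_eq_mul, hx, hDc, Derivation.commutator_apply]
      ring

theorem rhoF_mul {n r i : ℕ} (hi : 1 ≤ i) (hin : i ≤ n) (m : ℤ) {l : ℕ} {e : ℕ → ℕ → ℂ}
    {p q : FSp n} (hp : p ∈ xyAlg n r l e) (hq : q ∈ Algebra.adjoin ℂ (xGensAbove n r)) :
    ∃ p' ∈ xyAlg n r l e, rhoF n r i m (p * q) =
      p' * q + p * ((if r < i then xVar n i i m else 0) * q + rowDer n r i m q) := by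
  have hp0 : ∀ j, r < j → ∀ v : XIdx n, v.1.1.2 = j → pderiv (Sum.inl v) p = 0 :=
    fun j hj v hv => pderiv_inl_eq_zero_of_mem_xyAlg (hv ▸ hj) hp
  have hq0 : ∀ j, j ≤ r → ∀ v : XIdx n, v.1.1.2 = j → pderiv (Sum.inl v) q = 0 :=
    fun j hj v hv => pderiv_inl_eq_zero_of_mem_adjoin_xGensAbove (hv ▸ hj) hq
  refine ⟨(if r < i then 0 else aop n r i i m p) +
    ∑ j ∈ Finset.Icc (i + 1) n with ¬ r < j, aAstarMode n r i j m p, ?_, ?_⟩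
  · refine add_mem ?_ (sum_mem fun j hj => ?_)
    · split_ifs with h
      · exact zero_mem _
      · exact aop_mem_xyAlg _ _ _ (not_lt.1 h) _ hp
    · exact aAstarMode_mem_xyAlg _ _ _ (not_lt.1 (Finset.mem_filter.1 hj).2) _ hp
  · have h₁ : aop n r i i m (p * q) = (if r < i then 0 else aop n r i i m p) * q +
        p * ((if r < i then xVar n i i m else 0) * q) := by
      split_ifs with h
      · have hi' : 1 ≤ i ∧ i ≤ i ∧ i ≤ n := ⟨hi, le_rfl, hin⟩
        rw [aop, dif_pos hi', if_neg (by omega), xVar, dif_pos hi']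
        ring
      · simp [aop_mul r i i m (hq0 i (not_lt.1 h))]
    have h₂ : ∑ j ∈ Finset.Icc (i + 1) n with ¬ r < j, aAstarMode n r i j m (p * q) =
        (∑ j ∈ Finset.Icc (i + 1) n with ¬ r < j, aAstarMode n r i j m p) * q := by
      rw [Finset.sum_mul]
      exact Finset.sum_congr rfl fun j hj =>
        aAstarMode_mul r i j m (hq0 j (not_lt.1 (Finset.mem_filter.1 hj).2))
    have h₃ : ∑ j ∈ Finset.Icc (i + 1) n with r < j, aAstarMode n r i j m (p * q) =
        p * rowDer n r i m q := by
      rw [rowDer_apply, Finset.mul_sum]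
      refine Finset.sum_congr rfl fun j hj => ?_
      rw [Finset.mem_filter, Finset.mem_Icc] at hj
      rw [mul_comm, aAstarMode_mul r i j m (hp0 j hj.2),
        aAstarMode_eq_shiftDer hi hj.1.1 hj.1.2 hj.2, mul_comm]
    change aop n r i i m (p * q) + ∑ j ∈ Finset.Icc (i + 1) n, aAstarMode n r i j m (p * q) = _
    rw [← Finset.sum_filter_add_sum_filter_not _ (fun j => r < j), h₁, h₂, h₃]
    ring

theorem rowDer_mem_adjoin {n r i : ℕ} (m : ℤ) {q : FSp n}
    (hq : q ∈ Algebra.adjoin ℂ (xGensAbove n r)) :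
    rowDer n r i m q ∈ Algebra.adjoin ℂ (xGensAbove n r) := by
  refine Derivation.mem_adjoin_of_forall_mem _ ?_ hq
  rintro x ⟨v, hv, rfl⟩
  refine Algebra.span_le_adjoin ℂ _ (Submodule.span_mono ?_ (rowDer_X_mem n r i m v))
  rintro x ⟨w, hw, rfl⟩
  exact ⟨w, hw ▸ hv, rfl⟩

theorem xyAlg_le_of_rhoF_stable {n r l : ℕ} {e : ℕ → ℕ → ℂ} {V : Submodule ℂ (FSp n)}
    (hV : Subalgebra.toSubmodule (xyAlg n r l e) ≤ V)
    (hF : ∀ i, 1 ≤ i → i ≤ n → ∀ m : ℤ, ∀ q ∈ V, rhoF n r i m q ∈ V) :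
    Subalgebra.toSubmodule (xyAlg n n l e) ≤ V := by
  let U : Submodule ℂ (FSp n) :=
    { carrier := {q | q ∈ Algebra.adjoin ℂ (xGensAbove n r) ∧ ∀ p ∈ xyAlg n r l e, p * q ∈ V}
      zero_mem' := ⟨zero_mem _, fun p _ => by simp⟩
      add_mem' := fun ha hb => ⟨add_mem ha.1 hb.1, fun p hp => by
        rw [mul_add]; exact add_mem (ha.2 p hp) (hb.2 p hp)⟩
      smul_mem' := fun c a ha => ⟨Subalgebra.smul_mem _ ha.1 c, fun p hp => by
        rw [mul_smul_comm]; exact V.smul_mem c (ha.2 p hp)⟩ }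
  have hU : ∀ i, 1 ≤ i → i ≤ n → ∀ m : ℤ, ∀ q ∈ U,
      (if r < i then xVar n i i m else 0) * q + rowDer n r i m q ∈ U := by
    intro i hi hin m q hq
    refine ⟨add_mem (mul_mem ?_ hq.1) (rowDer_mem_adjoin m hq.1), fun p hp => ?_⟩
    · split_ifs with h
      · rw [xVar, dif_pos ⟨hi, le_rfl, hin⟩]
        exact Algebra.subset_adjoin ⟨_, h, rfl⟩
      · exact zero_mem _
    · obtain ⟨p', hp', h⟩ := rhoF_mul hi hin m hp hq.1
      have h' := sub_mem (hF i hi hin m _ (hq.2 p hp)) (hq.2 p' hp')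
      rwa [h, add_sub_cancel_left] at h'
  have hle : Subalgebra.toSubmodule (Algebra.adjoin ℂ (xGensAbove n r)) ≤ U := by
    refine adjoin_le_of_forall_mul_add_derivation_mem
      ⟨one_mem _, fun p hp => by rw [mul_one]; exact hV hp⟩ ?_
    rintro _ ⟨⟨⟨⟨i, j⟩, hi, hij, hj⟩, m⟩, hv, rfl⟩
    obtain ⟨D, hD, -, hDU⟩ := exists_derivation_xVar_mul_add_mem hU hij hi hj hv m
    refine ⟨D, ?_, fun q hq => ?_⟩
    · rintro _ ⟨v, hv, rfl⟩
      refine Submodule.span_mono ?_ (hD v)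
      rintro _ ⟨w, hw, rfl⟩
      exact ⟨w, hw ▸ hv, rfl⟩
    · have := hDU q hq
      rwa [xVar, dif_pos ⟨hi, hij, hj⟩] at this
  have hgen : xGens n n ∪ yGens n l e ⊆ (xGens n r ∪ yGens n l e) ∪ xGensAbove n r := by
    rintro _ (⟨v, -, rfl⟩ | hy)
    · rcases le_or_gt v.1.1.2 r with h | h
      · exact Or.inl (Or.inl ⟨v, h, rfl⟩)
      · exact Or.inr ⟨v, h, rfl⟩
    · exact Or.inl (Or.inr hy)
  intro q hq
  have hq' : q ∈ Subalgebra.toSubmodule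
      (Algebra.adjoin ℂ ((xGens n r ∪ yGens n l e) ∪ xGensAbove n r)) :=
    Algebra.adjoin_mono hgen hq
  rw [Algebra.adjoin_union_coe_submodule] at hq'
  exact Submodule.mul_le.2 (fun p hp u hu => (hle hu).2 p hp) hq'

theorem xyAlg_le_of_rhoH_stable {n r l : ℕ} {e : ℕ → ℕ → ℂ} {lam : ℕ → ℂ}
    {V : Submodule ℂ (FSp n)} (hV : Subalgebra.toSubmodule (xyAlg n n 0 e) ≤ V)
    (hH : ∀ i, 1 ≤ i → i ≤ n → ∀ m : ℤ, ∀ q ∈ V, rhoH n r e lam i m q ∈ V) (hl : l ≤ n) :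
    Subalgebra.toSubmodule (xyAlg n n l e) ≤ V := by
  let U : Submodule ℂ (FSp n) :=
    { carrier := {q | q ∈ CsY n l e ∧ ∀ p ∈ xyAlg n n 0 e, p * q ∈ V}
      zero_mem' := ⟨zero_mem _, fun p _ => by simp⟩
      add_mem' := fun ha hb => ⟨add_mem ha.1 hb.1, fun p hp => by
        rw [mul_add]; exact add_mem (ha.2 p hp) (hb.2 p hp)⟩
      smul_mem' := fun c a ha => ⟨Subalgebra.smul_mem _ ha.1 c, fun p hp => by
        rw [mul_smul_comm]; exact V.smul_mem c (ha.2 p hp)⟩ }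
  have hle : Subalgebra.toSubmodule (CsY n l e) ≤ U := by
    refine adjoin_le_of_forall_mul_add_derivation_mem
      ⟨one_mem _, fun p hp => by rw [mul_one]; exact hV hp⟩ ?_
    rintro _ ⟨i, m, hi, hil, rfl⟩
    refine ⟨0, fun y _ => by simp, fun q hq => ?_⟩
    rw [Derivation.zero_apply, add_zero]
    refine ⟨mul_mem (Algebra.subset_adjoin ⟨i, m, hi, hil, rfl⟩) hq.1, fun p hp => ?_⟩
    have hin : i ≤ n := hil.trans hl
    have h := sub_mem (hH i hi hin (-(m.1 : ℤ)) _ (hq.2 p hp))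
      (hq.2 _ (rhoHx_mem_xyAlg r i hin (-(m.1 : ℤ)) hp))
    rw [rhoH_eq, rhoHx_mul r i _ fun v => pderiv_inl_eq_zero_of_mem_CsY v hq.1,
      add_sub_cancel_left] at h
    have hm := m.2
    have hb : bop n e lam i (-(m.1 : ℤ)) (p * q) = yPoly n e i m * (p * q) := by
      have h₁ : ¬ 0 < -(m.1 : ℤ) := by omega
      have h₂ : ¬ -(m.1 : ℤ) = 0 := by omega
      simp only [bop, dif_neg h₁, dif_neg h₂, neg_neg, Int.toNat_natCast]
    rw [hb] at h
    convert h using 1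
    ring
  rw [← span_mul_eq_xyAlg, Submodule.span_le]
  rintro _ ⟨u, hu, v, hv, rfl⟩
  exact (hle hv).2 u (Algebra.adjoin_mono Set.subset_union_left hu)

/-- the smallest subspace of `F` containing `W_𝔞 = ℂ_r[𝐱]·ℂ_r[𝐲]` and
invariant under all the intermediate Wakimoto operators `ρ(E_i)_m, ρ(F_i)_m, ρ(H_i)_m`
(`1 ≤ i ≤ n`, `m ∈ ℤ`) is exactly `ℂ[𝐱]·ℂ_n[𝐲]`: the intermediate Wakimoto module is
generated by `W_𝔞(λ̃_r)`. -/
theorem wakimoto_generated_by_Wa (n r : ℕ) (γ : ℂ) (e : ℕ → ℕ → ℂ) (lam : ℕ → ℂ)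
    (hn : 1 ≤ n) (hr : r ≤ n)
    (he : ∀ i j, 1 ≤ i → i ≤ n → 1 ≤ j → j ≤ n →
      (∑ k : Fin n, e i (k.1 + 1) * e j (k.1 + 1)) = Bentry r γ i j) :
    sInf {V : Submodule ℂ (FSp n) | Wa n r e ≤ V ∧
        (∀ i : ℕ, 1 ≤ i → i ≤ n → ∀ m : ℤ, ∀ q ∈ V,
          rhoE n r γ e lam i m q ∈ V ∧ rhoF n r i m q ∈ V ∧ rhoH n r e lam i m q ∈ V)} =
      Submodule.span ℂ {w | ∃ u ∈ CX n, ∃ v ∈ CsY n n e, w = u * v} := by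
  rw [CX_eq, span_mul_eq_xyAlg]
  apply le_antisymm
  · refine sInf_le ⟨?_, fun i hi hin m q hq => ⟨rhoE_mem_xyAlg r γ lam i hi hin m hq,
      rhoF_mem_xyAlg r i hin m hq,
      add_mem (rhoHx_mem_xyAlg r i hin m hq) (bop_mem_xyAlg lam i hi hin m hq)⟩⟩
    rw [Wa, CrX, ← xGens, span_mul_eq_xyAlg]
    exact Algebra.adjoin_mono (Set.union_subset_union
      (fun _ ⟨v, hv, h⟩ => ⟨v, hv.trans hr, h⟩)
      fun _ ⟨i, m, hi, hir, h⟩ => ⟨i, m, hi, hir.trans hr, h⟩)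
  · refine le_sInf fun V ⟨hWa, hV⟩ => ?_
    rw [Wa, CrX, ← xGens, span_mul_eq_xyAlg] at hWa
    refine xyAlg_le_of_rhoH_stable (le_trans ?_ (xyAlg_le_of_rhoF_stable hWa
      fun i hi hin m q hq => (hV i hi hin m q hq).2.1))
      (fun i hi hin m q hq => (hV i hi hin m q hq).2.2) le_rfl
    exact Algebra.adjoin_mono (Set.union_subset_union_right _
      fun _ ⟨i, m, hi, hi0, h⟩ => ⟨i, m, hi, hi0.trans (Nat.zero_le r), h⟩)
end

section
/- Assume the matrix 𝔅 is non-degenerate (det 𝔅 ≠ 0), so that ℂ_n[𝐲] is the full polynomial ring in the variables y_{k,m} and the intermediate Wakimoto module is W = F. Then every nonzero subspace N of F that is invariant under all of the intermediate Wakimoto operators ρ(E_i)_m, ρ(F_i)_m, ρ(H_i)_m (1 ≤ i ≤ n, m ∈ ℤ) has nonzero intersection with W_𝔞 = ℂ_r[𝐱]·ℂ_r[𝐲]: N ∩ W_𝔞 ≠ {0}. -/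
open MvPolynomial

/-- The matrix `𝔅` as an `n × n` complex matrix. -/
noncomputable def Bmatrix (n r : ℕ) (γ : ℂ) : Matrix (Fin n) (Fin n) ℂ :=
  Matrix.of fun i j => Bentry r γ (i.1 + 1) (j.1 + 1)


section Filtration

variable {σ : Type*}

/-- The polynomials all of whose monomials have weight at most `d`. -/
noncomputable def weightLE (w : σ → ℤ) (d : ℤ) : Submodule ℂ (MvPolynomial σ ℂ) where
  carrier := {q | ∀ s, coeff s q ≠ 0 → Finsupp.weight w s ≤ d}
  add_mem' := by
    intro a b ha hb s hs
    by_cases h : coeff s a = 0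
    · refine hb s fun h' => hs ?_
      simp [h, h']
    · exact ha s h
  zero_mem' := by
    intro s hs
    simp at hs
  smul_mem' := by
    intro c a ha s hs
    refine ha s fun h => hs ?_
    simp [h]

theorem X_mul_mem_weightLE {w : σ → ℤ} {d : ℤ} {q : MvPolynomial σ ℂ} (hq : q ∈ weightLE w d)
    (v : σ) : X v * q ∈ weightLE w (d + w v) := by
  classical
  intro s hs
  rw [coeff_X_mul'] at hs
  split_ifs at hs with h
  · have h1 := hq _ hs
    have h2 : s = (s - Finsupp.single v 1) + Finsupp.single v 1 := by
      refine (tsub_add_cancel_of_le ?_).symm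
      simpa [Nat.one_le_iff_ne_zero] using h
    rw [h2, map_add, Finsupp.weight_single]
    simpa using h1
  · exact absurd rfl hs

theorem pderiv_mem_weightLE {w : σ → ℤ} {d : ℤ} {q : MvPolynomial σ ℂ} (hq : q ∈ weightLE w d)
    (v : σ) : pderiv v q ∈ weightLE w (d - w v) := by
  intro s hs
  rw [coeff_pderiv] at hs
  have h1 := hq (s + Finsupp.single v 1) (fun h => hs (by simp [h]))
  rw [map_add, Finsupp.weight_single] at h1
  simp at h1
  linarith

theorem exists_mem_weightLE (w : σ → ℤ) (q : MvPolynomial σ ℂ) :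
    ∃ d : ℕ, q ∈ weightLE w d := by
  obtain ⟨M, hM⟩ := (q.support.image (Finsupp.weight w)).exists_le
  refine ⟨M.toNat, fun s hs => ?_⟩
  have := hM _ (Finset.mem_image_of_mem _ (mem_support_iff.2 hs))
  omega

theorem eq_zero_of_mem_weightLE {w : σ → ℤ} (hw : ∀ v, 0 ≤ w v) {d : ℤ} (hd : d < 0)
    {q : MvPolynomial σ ℂ} (hq : q ∈ weightLE w d) : q = 0 := by
  ext s
  by_contra h
  have h1 := hq s h
  have h2 : 0 ≤ Finsupp.weight w s := by
    rw [Finsupp.weight_apply]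
    exact Finset.sum_nonneg fun v _ => smul_nonneg (Nat.zero_le _) (hw v)
  omega

/-- A nonzero subspace contains a nonzero element of minimal weight. -/
theorem exists_minimal_weight {w : σ → ℤ} (hw : ∀ v, 0 ≤ w v)
    (N : Submodule ℂ (MvPolynomial σ ℂ)) (hN : N ≠ ⊥) :
    ∃ q ∈ N, q ≠ 0 ∧ ∃ d : ℤ, q ∈ weightLE w d ∧ ∀ p ∈ N, p ∈ weightLE w (d - 1) → p = 0 := by
  classical
  have hex : ∃ d : ℕ, ∃ q ∈ N, q ≠ 0 ∧ q ∈ weightLE w d := by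
    obtain ⟨q, hq, h0⟩ := N.ne_bot_iff.1 hN
    obtain ⟨d, hd⟩ := exists_mem_weightLE w q
    exact ⟨d, q, hq, h0, hd⟩
  obtain ⟨q, hq, h0, hd⟩ := Nat.find_spec hex
  refine ⟨q, hq, h0, _, hd, fun p hp hpd => ?_⟩
  by_contra hp0
  rcases Nat.eq_zero_or_pos (Nat.find hex) with h | h
  · exact hp0 (eq_zero_of_mem_weightLE hw (by omega) hpd)
  · refine Nat.find_min hex (m := Nat.find hex - 1) (by omega) ⟨p, hp, hp0, ?_⟩
    rwa [Nat.cast_sub h, Nat.cast_one]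

theorem notMem_vars_of_pderiv_eq_zero {q : MvPolynomial σ ℂ} {v : σ} (h : pderiv v q = 0) :
    v ∉ q.vars := by
  classical
  intro hv
  obtain ⟨s, hs, hvs⟩ := (mem_vars_iff_mem_support v).1 hv
  have h1 := coeff_pderiv (i := v) q (s - Finsupp.single v 1)
  have h2 : (s - Finsupp.single v 1) + Finsupp.single v 1 = s := by
    refine tsub_add_cancel_of_le ?_
    simpa [Nat.one_le_iff_ne_zero] using hvs
  rw [h, h2, coeff_zero] at h1
  have h3 : coeff s q ≠ 0 := mem_support_iff.1 hs
  rcases mul_eq_zero.1 h1.symm with h4 | h4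
  · exact h3 h4
  · exact Nat.cast_add_one_ne_zero _ h4

theorem pderiv_comm (u v : σ) (q : MvPolynomial σ ℂ) :
    pderiv u (pderiv v q) = pderiv v (pderiv u q) := by
  classical
  have h : ⁅(pderiv u : Derivation ℂ (MvPolynomial σ ℂ) (MvPolynomial σ ℂ)), pderiv (R := ℂ) v⁆ = 0 := by
    refine derivation_ext fun i => ?_
    simp [Derivation.commutator_apply, pderiv_X, Pi.single_apply, apply_ite]
  have := DFunLike.congr_fun h q
  simpa [Derivation.commutator_apply, sub_eq_zero] using this

/-- The polynomials annihilated by `∂/∂X_v`. -/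
noncomputable def pderivKer (v : σ) : Submodule ℂ (MvPolynomial σ ℂ) :=
  LinearMap.ker (pderiv v : Derivation ℂ (MvPolynomial σ ℂ) (MvPolynomial σ ℂ)).toLinearMap

theorem mem_pderivKer {v : σ} {q : MvPolynomial σ ℂ} : q ∈ pderivKer v ↔ pderiv v q = 0 :=
  Iff.rfl

theorem pderiv_mem_pderivKer {v : σ} (u : σ) {q : MvPolynomial σ ℂ} (hq : q ∈ pderivKer v) :
    pderiv u q ∈ pderivKer v := by
  rw [mem_pderivKer] at *
  rw [pderiv_comm, hq, map_zero]

theorem X_mul_mem_pderivKer {v u : σ} (h : u ≠ v) {q : MvPolynomial σ ℂ} (hq : q ∈ pderivKer v) :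
    X u * q ∈ pderivKer v := by
  rw [mem_pderivKer] at *
  rw [pderiv_mul, hq, pderiv_X_of_ne h]
  simp

theorem Submodule.finsum_mem_of_forall {R M ι : Type*} [Semiring R] [AddCommMonoid M] [Module R M]
    (W : Submodule R M) {f : ι → M} (h : ∀ s, f s ∈ W) : ∑ᶠ s, f s ∈ W :=
  finsum_induction (· ∈ W) W.zero_mem (fun _ _ => W.add_mem) h

theorem pderiv_finsum_eq_single {v : σ} {f : ℤ → MvPolynomial σ ℂ}
    (hf : (Function.support f).Finite) (s₀ : ℤ) (h : ∀ s, s ≠ s₀ → f s ∈ pderivKer v) :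
    pderiv v (∑ᶠ s, f s) = pderiv v (f s₀) := by
  have h1 := AddMonoidHom.map_finsum
    ((pderiv v : Derivation ℂ (MvPolynomial σ ℂ) (MvPolynomial σ ℂ)).toLinearMap.toAddMonoidHom) hf
  refine h1.trans ?_
  exact finsum_eq_single _ s₀ fun s hs => h s hs

theorem finite_pderiv_ne_zero (q : MvPolynomial σ ℂ) {ι : Type*} {f : ι → σ}
    (hf : Function.Injective f) : {t | pderiv (f t) q ≠ 0}.Finite := by
  refine (q.vars.finite_toSet.preimage hf.injOn).subset fun t ht => ?_
  by_contra h
  exact ht (pderiv_eq_zero_of_notMem_vars h)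

theorem exists_pderiv_eq_zero (q : MvPolynomial σ ℂ) {ι : Type*} [Infinite ι] {f : ι → σ}
    (hf : Function.Injective f) : ∃ t, q ∈ pderivKer (f t) := by
  obtain ⟨t, ht⟩ := (finite_pderiv_ne_zero q hf).exists_notMem
  exact ⟨t, by simpa [mem_pderivKer] using ht⟩

end Filtration

section Operators

variable {n r : ℕ}

/-- The total content of the root `α_i + ⋯ + α_j` in the simple roots `α_k`, `k > r`. -/
def upperHeight (r i j : ℕ) : ℤ := max (j : ℤ) r - max ((i : ℤ) - 1) r

/-- The weight on the variables of `F` recording `upperHeight` of `x_{ij,m}`. -/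
def upperWeight (n r : ℕ) : XIdx n ⊕ YIdx n → ℤ :=
  Sum.elim (fun v => upperHeight r v.1.1.1 v.1.1.2) 0

theorem upperWeight_nonneg (v : XIdx n ⊕ YIdx n) : 0 ≤ upperWeight n r v := by
  rcases v with ⟨⟨⟨i, j⟩, h⟩, m⟩ | v
  · simp only [upperWeight, Sum.elim_inl, upperHeight]
    simp only at h
    omega
  · simp [upperWeight]

theorem aop_zero (i j : ℕ) (m : ℤ) : aop n r i j m 0 = 0 := by
  unfold aop
  split_ifs <;> simp

theorem astarop_zero (i j : ℕ) (m : ℤ) : astarop n r i j m 0 = 0 := by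
  unfold astarop
  split_ifs <;> simp

theorem astarop_of_lt {i j : ℕ} (h : 1 ≤ i ∧ i ≤ j ∧ j ≤ n) (hj : r < j) (m : ℤ) (q : FSp n) :
    astarop n r i j m q = -pderiv (Sum.inl (⟨(i, j), h⟩, -m)) q := by
  unfold astarop
  rw [dif_pos h, if_neg (by omega)]

theorem aop_of_mul {i j : ℕ} (h : 1 ≤ i ∧ i ≤ j ∧ j ≤ n) {m : ℤ} (hm : r < j ∨ m < 0)
    (q : FSp n) : aop n r i j m q = X (Sum.inl (⟨(i, j), h⟩, m)) * q := by
  unfold aop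
  rw [dif_pos h, if_neg (by omega)]

theorem nAAmode_zero (i j k l : ℕ) (m : ℤ) : nAAmode n r i j k l m 0 = 0 := by
  unfold nAAmode nAA
  refine finsum_eq_zero_of_forall_eq_zero fun s => ?_
  split_ifs <;> simp [aop_zero, astarop_zero]

theorem nAAmode_eq_zero {i j k l : ℕ} (hj : r < j) {q : FSp n}
    (h : ∀ s, astarop n r k l s q = 0) (m : ℤ) : nAAmode n r i j k l m q = 0 := by
  unfold nAAmode nAA
  refine finsum_eq_zero_of_forall_eq_zero fun s => ?_
  rw [if_neg (by omega)]
  simp [aop_zero, h]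

theorem aop_mem_weightLE {d : ℤ} {q : FSp n} (hq : q ∈ weightLE (upperWeight n r) d)
    (i j : ℕ) (m : ℤ) :
    aop n r i j m q ∈ weightLE (upperWeight n r) (d + upperHeight r i j) := by
  unfold aop
  split_ifs with h h'
  · have := pderiv_mem_weightLE hq (Sum.inl (⟨(i, j), h⟩, m))
    convert this using 2
    simp only [upperWeight, Sum.elim_inl, upperHeight]
    omega
  · exact X_mul_mem_weightLE hq (Sum.inl (⟨(i, j), h⟩, m))
  · exact Submodule.zero_mem _

theorem astarop_mem_weightLE {d : ℤ} {q : FSp n} (hq : q ∈ weightLE (upperWeight n r) d)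
    (i j : ℕ) (m : ℤ) :
    astarop n r i j m q ∈ weightLE (upperWeight n r) (d - upperHeight r i j) := by
  unfold astarop
  split_ifs with h h'
  · have := X_mul_mem_weightLE hq (Sum.inl (⟨(i, j), h⟩, -m))
    convert this using 2
    simp only [upperWeight, Sum.elim_inl, upperHeight]
    omega
  · exact Submodule.neg_mem _ (pderiv_mem_weightLE hq (Sum.inl (⟨(i, j), h⟩, -m)))
  · exact Submodule.zero_mem _

theorem bop_mem_weightLE {d : ℤ} {q : FSp n} (hq : q ∈ weightLE (upperWeight n r) d)
    (e : ℕ → ℕ → ℂ) (lam : ℕ → ℂ) (i : ℕ) (m : ℤ) :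
    bop n e lam i m q ∈ weightLE (upperWeight n r) d := by
  unfold bop
  split_ifs with h h'
  · refine Submodule.smul_mem _ _ (Submodule.sum_mem _ fun k _ => Submodule.smul_mem _ _ ?_)
    simpa [upperWeight] using
      pderiv_mem_weightLE hq (Sum.inr (k, ⟨m.toNat, by omega⟩))
  · exact Submodule.smul_mem _ _ hq
  · dsimp only
    rw [yPoly, Finset.sum_mul]
    refine Submodule.sum_mem _ fun k _ => ?_
    rw [smul_mul_assoc]
    refine Submodule.smul_mem _ _ ?_
    simpa [upperWeight] using
      X_mul_mem_weightLE hq (Sum.inr (k, ⟨(-m).toNat, by omega⟩))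

theorem nAAmode_mem_weightLE {d : ℤ} {q : FSp n} (hq : q ∈ weightLE (upperWeight n r) d)
    (k l : ℕ) (m : ℤ) : nAAmode n r k l k l m q ∈ weightLE (upperWeight n r) d := by
  unfold nAAmode nAA
  refine Submodule.finsum_mem_of_forall _ fun s => ?_
  split_ifs
  · simpa using astarop_mem_weightLE (aop_mem_weightLE hq k l s) k l (m - s)
  · simpa using aop_mem_weightLE (astarop_mem_weightLE hq k l (m - s)) k l s

/-- `ρ(E_i)_m` with `i > r` lowers the weight by one. -/
theorem rhoE_mem_weightLE (γ : ℂ) (e : ℕ → ℕ → ℂ) (lam : ℕ → ℂ) {d : ℤ} {q : FSp n}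
    (hq : q ∈ weightLE (upperWeight n r) d) {i : ℕ} (hi : r < i) (m : ℤ) :
    rhoE n r γ e lam i m q ∈ weightLE (upperWeight n r) (d - 1) := by
  have hii : upperHeight r i i = 1 := by unfold upperHeight; omega
  have hstar : ∀ s, ∀ p ∈ weightLE (upperWeight n r) d,
      astarop n r i i s p ∈ weightLE (upperWeight n r) (d - 1) := fun s p hp => by
    simpa only [hii] using astarop_mem_weightLE hp i i s
  unfold rhoE
  refine Submodule.sub_mem _ (Submodule.sub_mem _ (Submodule.sub_mem _ (Submodule.add_mem _
    ?_ ?_) ?_) ?_) ?_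
  · refine Submodule.finsum_mem_of_forall _ fun s => ?_
    unfold nStar
    rw [if_pos (by omega)]
    simp only [Pi.sub_apply, Finset.sum_apply]
    exact Submodule.sub_mem _
      (Submodule.sum_mem _ fun k _ => nAAmode_mem_weightLE (hstar s q hq) _ _ _)
      (Submodule.sum_mem _ fun k _ => nAAmode_mem_weightLE (hstar s q hq) _ _ _)
  · refine Submodule.sum_mem _ fun k hk => Submodule.finsum_mem_of_forall _ fun s => ?_
    have := aop_mem_weightLE (astarop_mem_weightLE hq i k (m - s)) (i + 1) k s
    rw [Finset.mem_Icc] at hk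
    convert this using 2
    unfold upperHeight
    omega
  · refine Submodule.sum_mem _ fun k hk => Submodule.finsum_mem_of_forall _ fun s => ?_
    have := aop_mem_weightLE (astarop_mem_weightLE hq k i (m - s)) k (i - 1) s
    rw [Finset.mem_Ico] at hk
    convert this using 2
    unfold upperHeight
    omega
  · exact Submodule.finsum_mem_of_forall _ fun s => hstar _ _ (bop_mem_weightLE hq _ _ _ _)
  · exact Submodule.smul_mem _ _ (Submodule.smul_mem _ _ (hstar m q hq))

theorem aop_mem_pderivKer {v : XIdx n ⊕ YIdx n} {q : FSp n} (hq : q ∈ pderivKer v)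
    {i j : ℕ} {m : ℤ} (hv : ∀ h, v ≠ Sum.inl (⟨(i, j), h⟩, m)) :
    aop n r i j m q ∈ pderivKer v := by
  unfold aop
  split_ifs with h h'
  · exact pderiv_mem_pderivKer _ hq
  · exact X_mul_mem_pderivKer (hv h).symm hq
  · exact Submodule.zero_mem _

theorem astarop_mem_pderivKer {v : XIdx n ⊕ YIdx n} {q : FSp n} (hq : q ∈ pderivKer v)
    {i j : ℕ} {m : ℤ} (hv : r < j ∨ ∀ h, v ≠ Sum.inl (⟨(i, j), h⟩, -m)) :
    astarop n r i j m q ∈ pderivKer v := by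
  unfold astarop
  split_ifs with h h'
  · exact X_mul_mem_pderivKer ((hv.resolve_left (by omega)) h).symm hq
  · exact Submodule.neg_mem _ (pderiv_mem_pderivKer _ hq)
  · exact Submodule.zero_mem _

theorem bop_mem_pderivKer {v : XIdx n ⊕ YIdx n} {q : FSp n} (hq : q ∈ pderivKer v)
    (e : ℕ → ℕ → ℂ) (lam : ℕ → ℂ) (i : ℕ) {m : ℤ}
    (hv : ∀ k : Fin n, ∀ t : {t : ℕ // 1 ≤ t}, (t : ℤ) = -m → v ≠ Sum.inr (k, t)) :
    bop n e lam i m q ∈ pderivKer v := by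
  unfold bop
  split_ifs with h h'
  · exact Submodule.smul_mem _ _ (Submodule.sum_mem _ fun k _ => Submodule.smul_mem _ _
      (pderiv_mem_pderivKer _ hq))
  · exact Submodule.smul_mem _ _ hq
  · dsimp only
    rw [yPoly, Finset.sum_mul]
    refine Submodule.sum_mem _ fun k _ => ?_
    rw [smul_mul_assoc]
    exact Submodule.smul_mem _ _
      (X_mul_mem_pderivKer (hv k ⟨(-m).toNat, by omega⟩ (by simp only; omega)).symm hq)

theorem nAAmode_mem_pderivKer_inr {k : Fin n} {t : {t : ℕ // 1 ≤ t}} {q : FSp n}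
    (hq : q ∈ pderivKer (Sum.inr (k, t))) (i j : ℕ) (m : ℤ) :
    nAAmode n r i j i j m q ∈ pderivKer (Sum.inr (k, t)) := by
  unfold nAAmode nAA
  refine Submodule.finsum_mem_of_forall _ fun s => ?_
  split_ifs
  · exact astarop_mem_pderivKer (aop_mem_pderivKer hq (by simp)) (by simp)
  · exact aop_mem_pderivKer (astarop_mem_pderivKer hq (by simp)) (by simp)

theorem pderiv_inr_bop_neg (e : ℕ → ℕ → ℂ) (lam : ℕ → ℂ) (i : ℕ) {k : Fin n}
    {t : {t : ℕ // 1 ≤ t}} {q : FSp n} (hq : q ∈ pderivKer (Sum.inr (k, t))) :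
    pderiv (Sum.inr (k, t)) (bop n e lam i (-(t : ℤ)) q) = e i (k.1 + 1) • q := by
  have ht := t.2
  have hs : (⟨(- -(t.1 : ℤ)).toNat, by omega⟩ : {t : ℕ // 1 ≤ t}) = t := Subtype.ext (by simp)
  unfold bop
  rw [dif_neg (by omega), dif_neg (by omega)]
  rw [hs, pderiv_mul, mem_pderivKer.1 hq, mul_zero, add_zero, yPoly, map_sum,
    Finset.sum_eq_single k]
  · simp
  · intro l _ hl
    rw [Derivation.map_smul, pderiv_X_of_ne (by simpa using hl), smul_zero]
  · simp

end Operators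

section SingularVectors

variable {n r : ℕ}

theorem finite_support_of_astarop {i j : ℕ} (h : 1 ≤ i ∧ i ≤ j ∧ j ≤ n) (hj : r < j) (q : FSp n)
    (m : ℤ) : {s | astarop n r i j (m - s) q ≠ 0}.Finite := by
  refine (finite_pderiv_ne_zero q (f := fun s : ℤ =>
    (Sum.inl (⟨(i, j), h⟩, -(m - s)) : XIdx n ⊕ YIdx n)) ?_).subset ?_
  · intro a b hab
    simpa using hab
  · intro s hs
    simpa [astarop_of_lt h hj] using hs

/-- A vector killed by all `ρ(E_i)_m` does not involve the variables `x_{ii,p}`. -/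
theorem pderiv_diag_eq_zero (γ : ℂ) (e : ℕ → ℕ → ℂ) (lam : ℕ → ℂ) {q : FSp n} {i : ℕ}
    (h : 1 ≤ i ∧ i ≤ i ∧ i ≤ n) (hi : r < i) {k : Fin n} (hk : e i (k.1 + 1) ≠ 0)
    (hq : ∀ m, rhoE n r γ e lam i m q = 0) (p : ℤ) :
    pderiv (Sum.inl (⟨(i, i), h⟩, p)) q = 0 := by
  obtain ⟨t, ht⟩ := exists_pderiv_eq_zero q
    (f := fun t : ℕ => (Sum.inr (k, ⟨t + 1, by omega⟩) : XIdx n ⊕ YIdx n))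
    (fun a b hab => by simpa using hab)
  set T : {t : ℕ // 1 ≤ t} := ⟨t + 1, by omega⟩
  have hstar : ∀ s, ∀ f ∈ pderivKer (Sum.inr (k, T)),
      astarop n r i i s f ∈ pderivKer (Sum.inr (k, T)) := fun s f hf =>
    astarop_mem_pderivKer hf (by simp)
  have hE := hq (-(T : ℤ) - p)
  unfold rhoE at hE
  rw [sub_eq_zero, sub_eq_iff_eq_add] at hE
  have hL : ∀ f g a : FSp n, f = g + a → f ∈ pderivKer (Sum.inr (k, T)) →
      g ∈ pderivKer (Sum.inr (k, T)) → pderiv (Sum.inr (k, T)) a = 0 := by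
    intro f g a hfg hf hg
    have : a = f - g := by rw [hfg]; ring
    rw [this]
    exact Submodule.sub_mem _ hf hg
  have h4 := hL _ _ _ hE ?_ ?_
  · rw [pderiv_finsum_eq_single ?_ (-p) ?_] at h4
    · rw [show -(T : ℤ) - p - -p = -(T : ℤ) by ring, astarop_of_lt h hi, neg_neg, map_neg,
        pderiv_comm, pderiv_inr_bop_neg e lam i ht, Derivation.map_smul, neg_eq_zero] at h4
      exact (smul_eq_zero.1 h4).resolve_left hk
    · refine (finite_pderiv_ne_zero q (f := fun s : ℤ =>
        (Sum.inl (⟨(i, i), h⟩, -s) : XIdx n ⊕ YIdx n)) ?_).subset ?_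
      · intro a b hab
        simpa using hab
      · intro s hs hs'
        refine hs ?_
        dsimp only
        rw [astarop_of_lt h hi, neg_eq_zero]
        exact bop_mem_pderivKer (mem_pderivKer.2 hs') e lam i (by simp)
    · intro s hs
      refine hstar _ _ (bop_mem_pderivKer ht e lam i ?_)
      intro k' t' ht' heq
      rw [Sum.inr.injEq, Prod.mk.injEq] at heq
      rw [← heq.2] at ht'
      omega
  · refine Submodule.sub_mem _ (Submodule.add_mem _ ?_ ?_) ?_
    · refine Submodule.finsum_mem_of_forall _ fun s => ?_
      unfold nStar
      rw [if_pos (by omega)]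
      simp only [Pi.sub_apply, Finset.sum_apply]
      exact Submodule.sub_mem _
        (Submodule.sum_mem _ fun k _ => nAAmode_mem_pderivKer_inr (hstar s q ht) _ _ _)
        (Submodule.sum_mem _ fun k _ => nAAmode_mem_pderivKer_inr (hstar s q ht) _ _ _)
    · refine Submodule.sum_mem _ fun k hk => Submodule.finsum_mem_of_forall _ fun s => ?_
      exact aop_mem_pderivKer (astarop_mem_pderivKer ht (by simp)) (by simp)
    · refine Submodule.sum_mem _ fun k hk => Submodule.finsum_mem_of_forall _ fun s => ?_
      exact aop_mem_pderivKer (astarop_mem_pderivKer ht (by simp)) (by simp)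
  · exact Submodule.smul_mem _ _ (Submodule.smul_mem _ _ (hstar _ q ht))

/-- A vector killed by all `ρ(E_i)_m` does not involve the variables `x_{ki,p}`, `k < i`. -/
theorem pderiv_offdiag_eq_zero (γ : ℂ) (e : ℕ → ℕ → ℂ) (lam : ℕ → ℂ) {q : FSp n} {k i : ℕ}
    (h : 1 ≤ k ∧ k ≤ i ∧ i ≤ n) (hki : k < i) (hi : r < i)
    (hdiag : ∀ h p, pderiv (Sum.inl (⟨(i, i), h⟩, p)) q = 0)
    (hq : ∀ m, rhoE n r γ e lam i m q = 0) (p : ℤ) :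
    pderiv (Sum.inl (⟨(k, i), h⟩, p)) q = 0 := by
  have hii : 1 ≤ i ∧ i ≤ i ∧ i ≤ n := by omega
  have hk1 : 1 ≤ k ∧ k ≤ i - 1 ∧ i - 1 ≤ n := by omega
  obtain ⟨t, ht⟩ := exists_pderiv_eq_zero q
    (f := fun t : ℕ => (Sum.inl (⟨(k, i - 1), hk1⟩, -(t : ℤ) - 1) : XIdx n ⊕ YIdx n))
    (fun a b hab => by simpa using hab)
  set S : ℤ := -(t : ℤ) - 1
  have hS : S < 0 := by omega
  have hstar : ∀ s, astarop n r i i s q = 0 := fun s => by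
    rw [astarop_of_lt hii hi, hdiag, neg_zero]
  have hE := hq (S - p)
  have hT1 : ∀ s, nStar n r i i s
      ((∑ k ∈ Finset.Ico 1 i, nAAmode n r k (i - 1) k (i - 1) (S - p - s))
        - ∑ k ∈ Finset.Icc 1 i, nAAmode n r k i k i (S - p - s)) q = 0 := by
    intro s
    unfold nStar
    rw [if_pos (by omega)]
    simp [hstar, nAAmode_zero]
  have hT4 : ∀ s, astarop n r i i s (bop n e lam i (S - p - s) q) = 0 := by
    intro s
    rw [astarop_of_lt hii hi, neg_eq_zero]
    exact bop_mem_pderivKer (mem_pderivKer.2 (hdiag hii _)) e lam i (by simp)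
  unfold rhoE at hE
  rw [finsum_eq_zero_of_forall_eq_zero hT1, finsum_eq_zero_of_forall_eq_zero hT4, hstar, smul_zero,
    smul_zero, sub_zero, sub_zero, zero_add, sub_eq_zero] at hE
  have hE' := congrArg (pderiv (Sum.inl (⟨(k, i - 1), hk1⟩, S))) hE
  have h2 : pderiv (Sum.inl (⟨(k, i - 1), hk1⟩, S)) (∑ k ∈ Finset.Icc (i + 1) n,
      ∑ᶠ s : ℤ, aop n r (i + 1) k s (astarop n r i k (S - p - s) q)) = 0 := by
    rw [← mem_pderivKer]
    refine Submodule.sum_mem _ fun l hl => Submodule.finsum_mem_of_forall _ fun s => ?_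
    rw [Finset.mem_Icc] at hl
    refine aop_mem_pderivKer (astarop_mem_pderivKer ht (Or.inl (by omega))) ?_
    intro h' heq
    simp only [Sum.inl.injEq, Prod.mk.injEq, Subtype.mk.injEq] at heq
    omega
  rw [h2, map_sum (pderiv _) _ (Finset.Ico 1 i), Finset.sum_eq_single k,
    pderiv_finsum_eq_single ?_ S ?_] at hE'
  · rw [aop_of_mul hk1 (Or.inr hS), pderiv_mul, pderiv_X_self, one_mul,
      astarop_of_lt h hi, map_neg, pderiv_comm, mem_pderivKer.1 ht] at hE'
    simpa using hE'.symm
  · refine (finite_support_of_astarop h hi q (S - p)).subset fun s hs hs' => hs ?_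
    dsimp only
    rw [hs', aop_zero]
  · intro s hs
    refine aop_mem_pderivKer (astarop_mem_pderivKer ht (Or.inl hi)) ?_
    intro h' heq
    simp only [Sum.inl.injEq, Prod.mk.injEq] at heq
    exact hs heq.2.symm
  · intro l hl hlk
    rw [← mem_pderivKer]
    refine Submodule.finsum_mem_of_forall _ fun s => ?_
    refine aop_mem_pderivKer (astarop_mem_pderivKer ht (Or.inl hi)) ?_
    intro h' heq
    simp only [Sum.inl.injEq, Prod.mk.injEq, Subtype.mk.injEq] at heq
    omega
  · intro hk
    rw [Finset.mem_Ico] at hk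
    omega

/-- The polynomials not involving the variables `x_{ij,m}` with `j > r`. -/
noncomputable def lowerX (n r : ℕ) : Submodule ℂ (FSp n) :=
  ⨅ v : {v : XIdx n // r < v.1.1.2}, pderivKer (Sum.inl v.1)

theorem mem_lowerX {q : FSp n} :
    q ∈ lowerX n r ↔ ∀ v : XIdx n, r < v.1.1.2 → pderiv (Sum.inl v) q = 0 := by
  simp [lowerX, Submodule.mem_iInf, mem_pderivKer]

theorem inf_lowerX_ne_bot {γ : ℂ} {e : ℕ → ℕ → ℂ} {lam : ℕ → ℂ}
    (hrow : ∀ i, 1 ≤ i → i ≤ n → ∃ k : Fin n, e i (k.1 + 1) ≠ 0)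
    {N : Submodule ℂ (FSp n)} (hN : N ≠ ⊥)
    (hinv : ∀ i : ℕ, 1 ≤ i → i ≤ n → ∀ m : ℤ, ∀ q ∈ N, rhoE n r γ e lam i m q ∈ N) :
    N ⊓ lowerX n r ≠ ⊥ := by
  obtain ⟨q, hq, hq0, d, hqd, hmin⟩ :=
    exists_minimal_weight (w := upperWeight n r) upperWeight_nonneg N hN
  have hE : ∀ i, 1 ≤ i → i ≤ n → r < i → ∀ m, rhoE n r γ e lam i m q = 0 := fun i h1 h2 h3 m =>
    hmin _ (hinv i h1 h2 m q hq) (rhoE_mem_weightLE γ e lam hqd h3 m)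
  refine (Submodule.ne_bot_iff _).2 ⟨q, ⟨hq, mem_lowerX.2 ?_⟩, hq0⟩
  rintro ⟨⟨⟨i, j⟩, h⟩, p⟩ hj
  simp only at h hj
  have hdiag : ∀ h p, pderiv (Sum.inl (⟨(j, j), h⟩, p)) q = 0 := fun h p => by
    obtain ⟨k, hk⟩ := hrow j h.1 h.2.2
    exact pderiv_diag_eq_zero γ e lam h hj hk (hE j h.1 h.2.2 hj) p
  rcases h.2.1.eq_or_lt with rfl | hlt
  · exact hdiag h p
  · exact pderiv_offdiag_eq_zero γ e lam h hlt hj hdiag (hE j (by omega) h.2.2 hj) p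

end SingularVectors

section Cartan

theorem sum_cartanEntry_Icc {i k l : ℕ} (hi : 1 ≤ i) (hkl : k ≤ l) :
    ∑ t ∈ Finset.Icc k l, cartanEntry i t =
      2 * (if k = i ∧ l = i then 1 else 0) + (if l = i ∧ k < i then 1 else 0)
        - (if l = i - 1 ∧ k < i then 1 else 0) + (if k = i ∧ i < l then 1 else 0)
        - (if k = i + 1 ∧ i < l then 1 else 0) := by
  have h : ∀ t, cartanEntry i t = (if t = i then 2 else 0) - (if t = i + 1 then 1 else 0)
      - (if t = i - 1 then 1 else 0) := by
    intro t
    unfold cartanEntry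
    split_ifs <;> first | omega | norm_num
  simp only [h, Finset.sum_sub_distrib, Finset.sum_ite_eq', Finset.mem_Icc]
  split_ifs <;> first | omega | norm_num

/-- The combination of root contributions in `ρ(H_i)` as a sum over all positive roots. -/
theorem cartan_sum_eq {E : Type*} [AddCommGroup E] [Module ℂ E] {n i : ℕ} (hi : 1 ≤ i)
    (hin : i ≤ n) (M : ℕ → ℕ → E) :
    (2 : ℂ) • M i i + ∑ j ∈ Finset.Ico 1 i, (M j i - M j (i - 1))
        + ∑ j ∈ Finset.Icc (i + 1) n, (M i j - M (i + 1) j)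
      = ∑ k ∈ Finset.Icc 1 n, ∑ l ∈ Finset.Icc k n,
          (∑ t ∈ Finset.Icc k l, cartanEntry i t) • M k l := by
  have hcol : ∀ j, 1 ≤ i → j ≤ n → i ≤ j + 1 →
      ∑ k ∈ Finset.Icc 1 n, ∑ l ∈ Finset.Icc k n, (if l = j ∧ k < i then M k l else 0)
        = ∑ k ∈ Finset.Ico 1 i, M k j := by
    intro j h1 h2 h3
    have : Finset.Ico 1 i = (Finset.Icc 1 n).filter (fun k => k < i) := by
      ext k
      simp only [Finset.mem_Ico, Finset.mem_filter, Finset.mem_Icc]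
      omega
    rw [this, Finset.sum_filter]
    refine Finset.sum_congr rfl fun k hk => ?_
    split_ifs with hki
    · rw [Finset.sum_eq_single j]
      · simp [hki]
      · intro l _ hl
        simp [hl]
      · intro hj
        rw [Finset.mem_Icc] at hj
        omega
    · exact Finset.sum_eq_zero fun l _ => by simp [hki]
  have hrow : ∀ j, 1 ≤ j → j ≤ i + 1 →
      ∑ k ∈ Finset.Icc 1 n, ∑ l ∈ Finset.Icc k n, (if k = j ∧ i < l then M k l else 0)
        = ∑ l ∈ Finset.Icc (i + 1) n, M j l := by
    intro j h1 h2
    by_cases hjn : j ≤ n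
    · rw [Finset.sum_eq_single j]
      · have : Finset.Icc (i + 1) n = (Finset.Icc j n).filter (fun l => i < l) := by
          ext k
          simp only [Finset.mem_filter, Finset.mem_Icc]
          omega
        rw [this, Finset.sum_filter]
        simp
      · intro k _ hk
        exact Finset.sum_eq_zero fun l _ => by simp [hk]
      · intro hj
        rw [Finset.mem_Icc] at hj
        omega
    · rw [Finset.Icc_eq_empty (by omega : ¬ i + 1 ≤ n), Finset.sum_empty]
      refine Finset.sum_eq_zero fun k hk => Finset.sum_eq_zero fun l _ => ?_
      rw [Finset.mem_Icc] at hk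
      rw [if_neg (by omega)]
  have hdiag : ∑ k ∈ Finset.Icc 1 n, ∑ l ∈ Finset.Icc k n,
      (if k = i ∧ l = i then M k l else 0) = M i i := by
    rw [Finset.sum_eq_single i, Finset.sum_eq_single i]
    · simp
    · intro l _ hl
      simp [hl]
    · intro h
      rw [Finset.mem_Icc] at h
      omega
    · intro k _ hk
      exact Finset.sum_eq_zero fun l _ => by simp [hk]
    · intro h
      rw [Finset.mem_Icc] at h
      omega
  have hR : ∑ k ∈ Finset.Icc 1 n, ∑ l ∈ Finset.Icc k n,
      (∑ t ∈ Finset.Icc k l, cartanEntry i t) • M k l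
      = ∑ k ∈ Finset.Icc 1 n, ∑ l ∈ Finset.Icc k n,
        ((2 : ℂ) • (if k = i ∧ l = i then M k l else 0) + (if l = i ∧ k < i then M k l else 0)
        - (if l = i - 1 ∧ k < i then M k l else 0) + (if k = i ∧ i < l then M k l else 0)
        - (if k = i + 1 ∧ i < l then M k l else 0)) := by
    refine Finset.sum_congr rfl fun k _ => Finset.sum_congr rfl fun l hl => ?_
    rw [sum_cartanEntry_Icc hi (Finset.mem_Icc.1 hl).1]
    simp only [add_smul, sub_smul, mul_smul, ite_smul, one_smul, zero_smul]
  rw [hR]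
  simp only [Finset.sum_add_distrib, Finset.sum_sub_distrib, ← Finset.smul_sum]
  rw [hdiag, hcol i hi hin (by omega), hcol (i - 1) hi (by omega) (by omega), hrow i hi (by omega),
    hrow (i + 1) (by omega) le_rfl]
  abel

/-- On polynomials without the variables `x_{ij,m}`, `j > r`, a combination of the `H_i`
orthogonal to the simple roots `α_1, …, α_r` acts through the Heisenberg operators only. -/
theorem sum_rhoH_eq {n r : ℕ} (e : ℕ → ℕ → ℂ) (lam : ℕ → ℂ) {q : FSp n} (hq : q ∈ lowerX n r)
    (c : Fin n → ℂ)
    (hc : ∀ t, 1 ≤ t → t ≤ r → ∑ j : Fin n, c j * cartanEntry (j.1 + 1) t = 0) (m : ℤ) :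
    ∑ j : Fin n, c j • rhoH n r e lam (j.1 + 1) m q
      = ∑ j : Fin n, c j • bop n e lam (j.1 + 1) m q := by
  have hM : ∀ k ∈ Finset.Icc 1 n, ∀ l ∈ Finset.Icc k n, r < l →
      nAAmode n r k l k l m q = 0 := by
    intro k hk l hl hrl
    rw [Finset.mem_Icc] at hk hl
    have h : 1 ≤ k ∧ k ≤ l ∧ l ≤ n := by omega
    refine nAAmode_eq_zero hrl (fun s => ?_) m
    rw [astarop_of_lt h hrl, mem_lowerX.1 hq (⟨(k, l), h⟩, -s) hrl, neg_zero]
  have hH : ∀ j : Fin n, rhoH n r e lam (j.1 + 1) m q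
      = ∑ k ∈ Finset.Icc 1 n, ∑ l ∈ Finset.Icc k n,
          (∑ t ∈ Finset.Icc k l, cartanEntry (j.1 + 1) t) • nAAmode n r k l k l m q
        + bop n e lam (j.1 + 1) m q := by
    intro j
    rw [← cartan_sum_eq (by omega) (by omega) (fun k l => nAAmode n r k l k l m q)]
    rfl
  simp only [hH, smul_add, Finset.sum_add_distrib]
  rw [add_eq_right]
  simp only [Finset.smul_sum, smul_smul]
  rw [Finset.sum_comm]
  refine Finset.sum_eq_zero fun k hk => ?_
  rw [Finset.sum_comm]
  refine Finset.sum_eq_zero fun l hl => ?_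
  by_cases hrl : r < l
  · simp [hM k hk l hl hrl]
  · rw [← Finset.sum_smul]
    simp only [Finset.mul_sum]
    rw [Finset.sum_comm, Finset.sum_eq_zero, zero_smul]
    intro t ht
    rw [Finset.mem_Icc] at hk ht
    exact hc t (by omega) (by omega)

end Cartan

section ChangeOfVariables

variable {n r : ℕ}

/-- The substitution `y_{k,m} ↦ ∑ l, P k l • y_{l,m}` fixing the `x` variables. -/
noncomputable def ySubst (P : Matrix (Fin n) (Fin n) ℂ) : FSp n →ₐ[ℂ] FSp n :=
  aeval (Sum.elim (fun v => X (Sum.inl v)) fun v => ∑ l, P v.1 l • X (Sum.inr (l, v.2)))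

theorem ySubst_X_inl (P : Matrix (Fin n) (Fin n) ℂ) (v : XIdx n) :
    ySubst P (X (Sum.inl v)) = X (Sum.inl v) := by
  simp [ySubst]

theorem ySubst_X_inr (P : Matrix (Fin n) (Fin n) ℂ) (v : YIdx n) :
    ySubst P (X (Sum.inr v)) = ∑ l, P v.1 l • X (Sum.inr (l, v.2)) := by
  simp [ySubst]

theorem ySubst_ySubst {P Q : Matrix (Fin n) (Fin n) ℂ} (h : Q * P = 1) (q : FSp n) :
    ySubst P (ySubst Q q) = q := by
  have : (ySubst P).comp (ySubst Q) = AlgHom.id ℂ _ := by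
    refine algHom_ext fun v => ?_
    rcases v with v | ⟨k, m⟩
    · simp [ySubst_X_inl]
    · simp only [AlgHom.comp_apply, ySubst_X_inr, map_sum, map_smul, AlgHom.id_apply,
        Finset.smul_sum, smul_smul]
      rw [Finset.sum_comm]
      simp only [← Finset.sum_smul, ← Matrix.mul_apply, h]
      simp [Matrix.one_apply, ite_smul]
  exact DFunLike.congr_fun this q

theorem pderiv_inl_ySubst (P : Matrix (Fin n) (Fin n) ℂ) (v : XIdx n) (q : FSp n) :
    pderiv (Sum.inl v) (ySubst P q) = ySubst P (pderiv (Sum.inl v) q) := by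
  induction q using MvPolynomial.induction_on with
  | C a => simp [ySubst]
  | add p q hp hq => simp only [map_add, hp, hq]
  | mul_X p u hp =>
    have hX : pderiv (Sum.inl v) (ySubst P (X u)) = ySubst P (pderiv (Sum.inl v) (X u)) := by
      classical
      rcases u with u | u
      · rw [ySubst_X_inl, pderiv_X]
        by_cases h : u = v <;> simp [h]
      · rw [ySubst_X_inr]
        simp [map_sum, pderiv_X]
    simp only [map_mul, pderiv_mul, map_add, hp, hX]

theorem pderiv_inr_ySubst (P : Matrix (Fin n) (Fin n) ℂ) (i : Fin n) (m : {m : ℕ // 1 ≤ m})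
    (q : FSp n) :
    pderiv (Sum.inr (i, m)) (ySubst P q)
      = ySubst P (∑ k, P k i • pderiv (Sum.inr (k, m)) q) := by
  induction q using MvPolynomial.induction_on with
  | C a => simp [ySubst]
  | add p q hp hq => simp only [map_add, hp, hq, smul_add, Finset.sum_add_distrib]
  | mul_X p u hp =>
    have hX : pderiv (Sum.inr (i, m)) (ySubst P (X u))
        = ySubst P (∑ k, P k i • pderiv (Sum.inr (k, m)) (X u)) := by
      classical
      rcases u with u | ⟨l, t⟩
      · rw [ySubst_X_inl]
        simp [pderiv_X]
      · rw [ySubst_X_inr]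
        by_cases h : t = m
        · subst h
          simp [map_sum, pderiv_X, Pi.single_apply]
        · simp [map_sum, pderiv_X, h]
    rw [map_mul, pderiv_mul, hp, hX, ← map_mul, ← map_mul, ← map_add]
    congr 1
    simp only [pderiv_mul, smul_add, Finset.sum_add_distrib, Finset.sum_mul, Finset.mul_sum,
      smul_mul_assoc, mul_smul_comm]

theorem Wa_eq_sup (n r : ℕ) (e : ℕ → ℕ → ℂ) :
    Wa n r e = Subalgebra.toSubmodule (CrX n r ⊔ CsY n r e) := by
  rw [← Subalgebra.mul_toSubmodule, Submodule.mul_eq_span_mul_set]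
  unfold Wa
  congr 1
  ext w
  simp only [Set.mem_ofPred_eq, Set.mem_mul, SetLike.mem_coe, Subalgebra.mem_toSubmodule]
  constructor
  · rintro ⟨u, hu, v, hv, rfl⟩
    exact ⟨u, hu, v, hv, rfl⟩
  · rintro ⟨u, hu, v, hv, rfl⟩
    exact ⟨u, hu, v, hv, rfl⟩

theorem ySubst_X_inr_eq_yPoly (e : ℕ → ℕ → ℂ) (v : YIdx n) :
    ySubst (Matrix.of fun i k : Fin n => e (i.1 + 1) (k.1 + 1)) (X (Sum.inr v))
      = yPoly n e (v.1.1 + 1) v.2 := by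
  simp only [ySubst_X_inr, yPoly, Matrix.of_apply]

/-- The variables `x_{ij,m}` with `j ≤ r` and `y_{k,m}` with `k ≤ r`. -/
def lowerVars (n r : ℕ) : Set (XIdx n ⊕ YIdx n) :=
  Sum.inl '' {v | v.1.1.2 ≤ r} ∪ Sum.inr '' {v | v.1.1 < r}

theorem ySubst_mem_of_supported (e : ℕ → ℕ → ℂ) {q : FSp n}
    (hq : q ∈ supported ℂ (lowerVars n r)) :
    ySubst (Matrix.of fun i k : Fin n => e (i.1 + 1) (k.1 + 1)) q ∈ CrX n r ⊔ CsY n r e := by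
  rw [supported_eq_adjoin_X] at hq
  induction hq using Algebra.adjoin_induction with
  | mem p hp =>
    rcases hp with ⟨_, ⟨v, hv, rfl⟩ | ⟨v, hv, rfl⟩, rfl⟩
    · rw [ySubst_X_inl]
      have h : X (Sum.inl v) ∈ CrX n r := Algebra.subset_adjoin ⟨v, hv, rfl⟩
      exact (le_sup_left : CrX n r ≤ CrX n r ⊔ CsY n r e) h
    · rw [ySubst_X_inr_eq_yPoly]
      have h : yPoly n e (v.1.1 + 1) v.2 ∈ CsY n r e :=
        Algebra.subset_adjoin ⟨v.1.1 + 1, v.2, Nat.le_add_left _ _, hv, rfl⟩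
      exact (le_sup_right : CsY n r e ≤ CrX n r ⊔ CsY n r e) h
  | algebraMap c =>
    rw [AlgHom.commutes]
    exact Subalgebra.algebraMap_mem _ c
  | add p p' _ _ hp hp' =>
    rw [map_add]
    exact Subalgebra.add_mem _ hp hp'
  | mul p p' _ _ hp hp' =>
    rw [map_mul]
    exact Subalgebra.mul_mem _ hp hp'

/-- Membership in `W_𝔞` is detected by derivatives in the directions dual to the
remaining generators. -/
theorem mem_Wa_of_pderiv {e : ℕ → ℕ → ℂ} {Q : Matrix (Fin n) (Fin n) ℂ}
    (hQ : Q * (Matrix.of fun i k : Fin n => e (i.1 + 1) (k.1 + 1)) = 1)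
    {q : FSp n} (hx : q ∈ lowerX n r)
    (hy : ∀ i : Fin n, r ≤ i.1 → ∀ m, ∑ k, Q k i • pderiv (Sum.inr (k, m)) q = 0) :
    q ∈ Wa n r e := by
  rw [Wa_eq_sup, Subalgebra.mem_toSubmodule]
  rw [← ySubst_ySubst hQ q]
  refine ySubst_mem_of_supported e ?_
  rw [mem_supported]
  intro v hv
  by_contra hvS
  refine notMem_vars_of_pderiv_eq_zero ?_ hv
  rcases v with v | ⟨i, m⟩
  · have hv' : r < v.1.1.2 := not_le.1 fun h => hvS (Or.inl ⟨v, h, rfl⟩)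
    rw [pderiv_inl_ySubst, mem_lowerX.1 hx v hv', map_zero]
  · have hi : r ≤ i.1 := not_lt.1 fun h => hvS (Or.inr ⟨(i, m), h, rfl⟩)
    rw [pderiv_inr_ySubst, hy i hi, map_zero]

end ChangeOfVariables

section NonDegenerate

variable {n r : ℕ} {γ : ℂ}

theorem cartanEntry_comm (i j : ℕ) : cartanEntry i j = cartanEntry j i := by
  unfold cartanEntry
  split_ifs <;> first | rfl | omega

theorem Bentry_of_le {i : ℕ} (hi : i ≤ r) (j : ℕ) :
    Bentry r γ i j = cartanEntry j i * γ ^ 2 := by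
  unfold Bentry
  rw [if_neg (by omega : ¬ r < i), if_neg (by omega : i ≠ r + 1), cartanEntry_comm]
  ring

theorem sum_Bmatrix_inv_mul_cartanEntry (hdet : (Bmatrix n r γ).det ≠ 0)
    {i : Fin n} (hi : r ≤ i.1) {t : ℕ} (ht : 1 ≤ t) (htr : t ≤ r) :
    ∑ j : Fin n, (Bmatrix n r γ)⁻¹ j i * cartanEntry (j.1 + 1) t = 0 := by
  have hB : Bmatrix n r γ * (Bmatrix n r γ)⁻¹ = 1 :=
    Matrix.mul_nonsing_inv _ (isUnit_iff_ne_zero.2 hdet)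
  set T : Fin n := ⟨t - 1, by omega⟩ with hT
  have hrow : ∀ l, (Bmatrix n r γ * (Bmatrix n r γ)⁻¹) T l
      = γ ^ 2 * ∑ j : Fin n, (Bmatrix n r γ)⁻¹ j l * cartanEntry (j.1 + 1) t := by
    intro l
    rw [Matrix.mul_apply, Finset.mul_sum]
    refine Finset.sum_congr rfl fun j _ => ?_
    have : Bmatrix n r γ T j = cartanEntry (j.1 + 1) t * γ ^ 2 := by
      have h1 : T.1 + 1 = t := by simp only [hT]; omega
      rw [Bmatrix, Matrix.of_apply, h1, Bentry_of_le htr]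
    rw [this]
    ring
  have hγ : γ ^ 2 ≠ 0 := by
    intro h
    have := hrow T
    rw [hB, h, zero_mul, Matrix.one_apply_eq] at this
    exact one_ne_zero this
  have hTi : T ≠ i := fun h => by
    have := congrArg Fin.val h
    simp only [hT] at this
    omega
  have := hrow i
  rw [hB, Matrix.one_apply_ne hTi] at this
  exact (mul_eq_zero.1 this.symm).resolve_left hγ

theorem exists_ne_zero_of_mul_eq_one {P Q : Matrix (Fin n) (Fin n) ℂ} (h : P * Q = 1)
    (i : Fin n) : ∃ k, P i k ≠ 0 := by
  by_contra! h0
  have := congrFun (congrFun h i) i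
  rw [Matrix.mul_apply, Matrix.one_apply_eq] at this
  simp [h0] at this

theorem bop_of_pos (e : ℕ → ℕ → ℂ) (lam : ℕ → ℂ) (i : ℕ) (m : {m : ℕ // 1 ≤ m}) (q : FSp n) :
    bop n e lam i (m : ℤ) q
      = ((m : ℕ) : ℂ) • ∑ k : Fin n, e i (k.1 + 1) • pderiv (Sum.inr (k, m)) q := by
  have hm := m.2
  unfold bop
  rw [dif_pos (by omega)]
  simp

/-- The weight on the variables of `F` counting the `y` variables. -/
def yWeight (n : ℕ) : XIdx n ⊕ YIdx n → ℤ := Sum.elim 0 1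

theorem yWeight_nonneg (v : XIdx n ⊕ YIdx n) : 0 ≤ yWeight n v := by
  rcases v with v | v <;> simp [yWeight]

end NonDegenerate

/-- if `𝔅` is non-degenerate (so the intermediate Wakimoto module is
all of `F`), then every nonzero subspace `N` of `F` invariant under all of the
intermediate Wakimoto operators `ρ(E_i)_m, ρ(F_i)_m, ρ(H_i)_m` (`1 ≤ i ≤ n`, `m ∈ ℤ`)
meets `W_𝔞 = ℂ_r[𝐱]·ℂ_r[𝐲]` non-trivially: `N ⊓ W_𝔞 ≠ 0`. -/
theorem wakimoto_submodule_meets_Wa (n r : ℕ) (γ : ℂ) (e : ℕ → ℕ → ℂ) (lam : ℕ → ℂ)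
    (hn : 1 ≤ n) (hr : r ≤ n)
    (he : ∀ i j, 1 ≤ i → i ≤ n → 1 ≤ j → j ≤ n →
      (∑ k : Fin n, e i (k.1 + 1) * e j (k.1 + 1)) = Bentry r γ i j)
    (hdet : (Bmatrix n r γ).det ≠ 0)
    (N : Submodule ℂ (FSp n)) (hN : N ≠ ⊥)
    (hinv : ∀ i : ℕ, 1 ≤ i → i ≤ n → ∀ m : ℤ, ∀ q ∈ N,
      rhoE n r γ e lam i m q ∈ N ∧ rhoF n r i m q ∈ N ∧ rhoH n r e lam i m q ∈ N) :
    N ⊓ Wa n r e ≠ ⊥ := by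
  have hB : Bmatrix n r γ * (Bmatrix n r γ)⁻¹ = 1 :=
    Matrix.mul_nonsing_inv _ (isUnit_iff_ne_zero.2 hdet)
  set P : Matrix (Fin n) (Fin n) ℂ := Matrix.of fun i k : Fin n => e (i.1 + 1) (k.1 + 1) with hP
  have hPB : P * P.transpose = Bmatrix n r γ := by
    ext i j
    rw [Matrix.mul_apply]
    exact he _ _ (by omega) (by omega) (by omega) (by omega)
  set Q : Matrix (Fin n) (Fin n) ℂ := P.transpose * (Bmatrix n r γ)⁻¹ with hQ
  have hPQ : P * Q = 1 := by rw [hQ, ← Matrix.mul_assoc, hPB, hB]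
  have hQP : Q * P = 1 := mul_eq_one_comm.1 hPQ
  have hrow : ∀ i, 1 ≤ i → i ≤ n → ∃ k : Fin n, e i (k.1 + 1) ≠ 0 := by
    intro i h1 h2
    obtain ⟨k, hk⟩ := exists_ne_zero_of_mul_eq_one hPQ ⟨i - 1, by omega⟩
    refine ⟨k, ?_⟩
    rwa [hP, Matrix.of_apply, Nat.sub_add_cancel h1] at hk
  have hN' : N ⊓ lowerX n r ≠ ⊥ := inf_lowerX_ne_bot hrow hN
    fun i h1 h2 m q hq => (hinv i h1 h2 m q hq).1
  obtain ⟨q, ⟨hq, hqx⟩, hq0, d, hqd, hmin⟩ := exists_minimal_weight yWeight_nonneg _ hN'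
  refine (Submodule.ne_bot_iff _).2 ⟨q, ⟨hq, mem_Wa_of_pderiv hQP hqx fun i hi m => ?_⟩, hq0⟩
  have hm : ((m : ℕ) : ℂ) ≠ 0 := Nat.cast_ne_zero.2 (by have := m.2; omega)
  refine hmin _ ⟨?_, ?_⟩ ?_
  · have hH : ∑ j : Fin n, (Bmatrix n r γ)⁻¹ j i • rhoH n r e lam (j.1 + 1) (m : ℤ) q ∈ N :=
      Submodule.sum_mem _ fun j _ => Submodule.smul_mem _ _
        (hinv _ (by omega) (by omega) _ q hq).2.2
    rw [sum_rhoH_eq e lam hqx _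
      (fun t ht htr => sum_Bmatrix_inv_mul_cartanEntry hdet hi ht htr)] at hH
    simp only [bop_of_pos] at hH
    refine (N.smul_mem_iff hm).1 ?_
    convert hH using 1
    simp only [hQ, Matrix.mul_apply, Matrix.transpose_apply, hP, Matrix.of_apply, Finset.smul_sum,
      Finset.sum_smul, smul_smul]
    rw [Finset.sum_comm]
    refine Finset.sum_congr rfl fun j _ => Finset.sum_congr rfl fun k _ => ?_
    congr 1
    ring
  · rw [lowerX, SetLike.mem_coe, Submodule.mem_iInf] at hqx
    rw [lowerX, SetLike.mem_coe, Submodule.mem_iInf]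
    exact fun v => Submodule.sum_mem _ fun k _ => Submodule.smul_mem _ _
      (pderiv_mem_pderivKer _ (hqx v))
  · refine Submodule.sum_mem _ fun k _ => Submodule.smul_mem _ _ ?_
    simpa [yWeight] using pderiv_mem_weightLE hqd (Sum.inr (k, m))
end
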